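/- arXiv:2512.02915 — 2 statements merged into one kernel-verified Lean document; each statement's English description precedes it below -/
import Mathlib

section
/- For every positive integer r there exists a constant C(r) > 0 with the following property: for every odd prime q, every positive integer h with r ≤ h < q, and every real g with 1 ≤ g ≤ q, one has |Σ_{m=1}^{⌊g⌋} S_h(m,q)^{2r} − K(r,h)·⌊g⌋| ≤ C(r)·( h^{2r}·q^{1/2}·log q + h^r ). -/
open scoped Classical

noncomputable section

/-- `S h x q = ∑_{x < n ≤ x + h} (n/q)`, where `(n/q)` is the Legendre symbol
(realized by the Jacobi symbol, which agrees with it for prime `q`). -/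
def S (h : ℕ) (x : ℝ) (q : ℕ) : ℤ :=
  ∑ j ∈ Finset.Icc 1 h, jacobiSym (⌊x⌋ + j) q

/-- `K r h`: the number of tuples `α ∈ {1,…,h}^{2r}` in which every value occurs
an even number of times. -/
def K (r h : ℕ) : ℕ :=
  (Finset.univ.filter (fun α : Fin (2 * r) → Fin h =>
    ∀ v : Fin h, Even ((Finset.univ.filter fun i => α i = v).card))).card

section Stepanov

open Polynomial

variable {K : Type*} [Field K]

theorem eq_zero_of_sq_eq_C_mul_sq_mul {F : K[X]} (hF : Squarefree F) (hd : 0 < F.natDegree)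
    {c : K} (hc : c ≠ 0) {u v : K[X]} (h : u ^ 2 = C c * v ^ 2 * F) : v = 0 := by
  by_contra hv
  have hF0 : F ≠ 0 := by rintro rfl; simp at hd
  obtain ⟨P, hP, hPF⟩ := WfDvdMonoid.exists_irreducible_factor
    (fun hu => hd.ne' (natDegree_eq_zero_of_isUnit hu)) hF0
  have hPp := hP.prime
  have hu : u ≠ 0 := by
    rintro rfl
    have : C c * v ^ 2 * F ≠ 0 := by simp [hc, hv, hF0]
    exact this (by rw [← h]; simp)
  have hfu : FiniteMultiplicity P u := FiniteMultiplicity.of_not_isUnit hP.not_isUnit hu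
  have hfv : FiniteMultiplicity P v := FiniteMultiplicity.of_not_isUnit hP.not_isUnit hv
  have hFm : emultiplicity P F = 1 := by
    refine le_antisymm ?_ ?_
    · exact ((squarefree_iff_emultiplicity_le_one F).1 hF P).resolve_right hP.not_isUnit
    · have := pow_dvd_iff_le_emultiplicity.1 (by simpa using hPF : P ^ 1 ∣ F)
      simpa using this
  have hCm : emultiplicity P (C c) = 0 := by
    refine emultiplicity_eq_zero.2 fun hdvd => hP.not_isUnit ?_
    exact isUnit_of_dvd_unit hdvd (isUnit_C.2 hc.isUnit)
  have e := congrArg (emultiplicity P) h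
  rw [emultiplicity_mul hPp, emultiplicity_mul hPp, emultiplicity_pow hPp, emultiplicity_pow hPp,
    hFm, hCm, hfu.emultiplicity_eq_multiplicity, hfv.emultiplicity_eq_multiplicity] at e
  norm_cast at e
  omega

theorem eq_zero_of_X_pow_dvd_add_mul_pow {p κ t : ℕ} [ExpChar K p] (hM : p ^ κ = 2 * t + 1)
    {F : K[X]} (hF : Squarefree F) (hd : 0 < F.natDegree) (h0 : F.eval 0 ≠ 0)
    {u v : K[X]} (hu : 2 * u.natDegree ≤ 2 * t) (hv : 2 * v.natDegree + F.natDegree ≤ 2 * t)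
    (h : X ^ (2 * t + 1) ∣ u + v * F ^ (t + 1)) : u = 0 ∧ v = 0 := by
  have h1 : (X : K[X]) ^ (2 * t + 1) ∣ F ^ (2 * t + 1) - C (F.eval 0 ^ (2 * t + 1)) := by
    have : (X : K[X]) ∣ F - C (F.eval 0) := by
      rw [X_dvd_iff]; simp [coeff_zero_eq_eval_zero]
    have := pow_dvd_pow_of_dvd this (2 * t + 1)
    rw [← hM] at this ⊢
    rwa [sub_pow_expChar_pow, ← C_pow] at this
  have h2 : (X : K[X]) ^ (2 * t + 1) ∣ u ^ 2 - C (F.eval 0 ^ (2 * t + 1)) * v ^ 2 * F := by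
    have e : u ^ 2 - C (F.eval 0 ^ (2 * t + 1)) * v ^ 2 * F =
        (u + v * F ^ (t + 1)) * (u - v * F ^ (t + 1)) +
        (F ^ (2 * t + 1) - C (F.eval 0 ^ (2 * t + 1))) * (v ^ 2 * F) := by ring
    rw [e]
    exact dvd_add (h.mul_right _) (h1.mul_right _)
  have hc : F.eval 0 ^ (2 * t + 1) ≠ 0 := pow_ne_zero _ h0
  have h3 : u ^ 2 - C (F.eval 0 ^ (2 * t + 1)) * v ^ 2 * F = 0 := by
    refine eq_zero_of_dvd_of_natDegree_lt h2 ?_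
    rw [natDegree_X_pow]
    refine Nat.lt_succ_of_le ((natDegree_sub_le _ _).trans (max_le ?_ ?_))
    · exact (natDegree_pow_le).trans hu
    · refine natDegree_mul_le.trans ?_
      have : (C (F.eval 0 ^ (2 * t + 1)) * v ^ 2).natDegree ≤ 2 * v.natDegree :=
        (natDegree_C_mul_le _ _).trans natDegree_pow_le
      omega
  have hv0 := eq_zero_of_sq_eq_C_mul_sq_mul hF hd hc (sub_eq_zero.1 h3)
  refine ⟨?_, hv0⟩
  subst hv0
  simpa using h3

theorem eq_zero_of_sum_add_mul_pow_mul_X_pow_eq_zero {p κ t : ℕ} [ExpChar K p]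
    (hM : p ^ κ = 2 * t + 1)
    {F : K[X]} (hF : Squarefree F) (hd : 0 < F.natDegree) (h0 : F.eval 0 ≠ 0) (J : ℕ)
    (u v : ℕ → K[X]) (hu : ∀ j, 2 * (u j).natDegree ≤ 2 * t)
    (hv : ∀ j, 2 * (v j).natDegree + F.natDegree ≤ 2 * t)
    (h : ∑ j ∈ Finset.range J, (u j + v j * F ^ (t + 1)) * X ^ (j * (2 * t + 1)) = 0) :
    ∀ j < J, u j = 0 ∧ v j = 0 := by
  induction J generalizing u v with
  | zero => simp
  | succ J ih =>
    rw [Finset.sum_range_succ'] at h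
    have e : ∑ j ∈ Finset.range J, (u (j + 1) + v (j + 1) * F ^ (t + 1)) *
        X ^ ((j + 1) * (2 * t + 1)) = X ^ (2 * t + 1) *
        ∑ j ∈ Finset.range J, (u (j + 1) + v (j + 1) * F ^ (t + 1)) * X ^ (j * (2 * t + 1)) := by
      rw [Finset.mul_sum]
      exact Finset.sum_congr rfl fun j _ => by ring
    rw [e] at h
    simp only [zero_mul, pow_zero, mul_one] at h
    have hz := eq_zero_of_X_pow_dvd_add_mul_pow hM hF hd h0 (hu 0) (hv 0)
      ((dvd_add_right (dvd_mul_right _ _)).1 (h ▸ dvd_zero _))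
    rw [hz.1, hz.2] at h
    simp only [zero_mul, add_zero, mul_eq_zero, pow_eq_zero_iff', X_ne_zero, false_and,
      false_or] at h
    have := ih (fun j => u (j + 1)) (fun j => v (j + 1)) (fun j => hu _) (fun j => hv _) h
    intro j hj
    cases j with
    | zero => exact hz
    | succ j => exact this j (by omega)

/-- The polynomial of degree `< L` with given coefficients. -/
def polyOfFn {L : ℕ} (c : Fin L → K) : K[X] := ∑ i, C (c i) * X ^ (i : ℕ)

theorem polyOfFn_natDegree_le {L : ℕ} (c : Fin L → K) : (polyOfFn c).natDegree ≤ L - 1 :=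
  natDegree_sum_le_of_forall_le _ _ fun i _ =>
    (natDegree_C_mul_X_pow_le _ _).trans (by have := i.2; omega)

theorem polyOfFn_coeff {L : ℕ} (c : Fin L → K) (i : Fin L) : (polyOfFn c).coeff i = c i := by
  simp only [polyOfFn, finsetSum_coeff, coeff_C_mul_X_pow]
  simp [Fin.val_inj]

theorem polyOfFn_sub {L : ℕ} (c d : Fin L → K) :
    polyOfFn (c - d) = polyOfFn c - polyOfFn d := by
  simp [polyOfFn, sub_mul, Finset.sum_sub_distrib]

theorem polyOfFn_eq_zero {L : ℕ} {c : Fin L → K} (h : polyOfFn c = 0) : c = 0 := by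
  funext i
  rw [← polyOfFn_coeff c i, h]; simp

variable [Fintype K]

/-- Pigeonhole construction of the auxiliary polynomials in Stepanov's method. -/
theorem exists_stepanov_family {p κ t : ℕ} [ExpChar K p] (hM : p ^ κ = 2 * t + 1)
    {F : K[X]} (hD : F.natDegree + 1 ≤ t) (ε : K) :
    ∃ u v : ℕ → K[X], (∀ j, 2 * (u j).natDegree + F.natDegree ≤ 2 * t) ∧
      (∀ j, 2 * (v j).natDegree + F.natDegree ≤ 2 * t) ∧
      (∃ j < t + 1 + F.natDegree, u j ≠ 0 ∨ v j ≠ 0) ∧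
      ∑ j ∈ Finset.range (t + 1 + F.natDegree),
        ((u j) ^ (2 * t + 1) + C ε * (v j) ^ (2 * t + 1) * F ^ (t + 1)) * X ^ j = 0 := by
  set D := F.natDegree with hDdef
  set L := (2 * t + 2 - D) / 2 with hL
  set J := t + 1 + D with hJ
  set B := (L - 1) * (2 * t + 1) + D * (t + 1) + J with hB
  let ext : (Fin J → Fin L → K) → ℕ → K[X] := fun c j =>
    if hj : j < J then polyOfFn (c ⟨j, hj⟩) else 0
  have ext_deg : ∀ c j, (ext c j).natDegree ≤ L - 1 := by
    intro c j
    simp only [ext]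
    split_ifs
    · exact polyOfFn_natDegree_le _
    · simp
  have ext_sub : ∀ c d j, ext (c - d) j = ext c j - ext d j := by
    intro c d j
    simp only [ext]
    split_ifs
    · exact polyOfFn_sub _ _
    · simp
  let δ : (Fin J → Fin L → K) × (Fin J → Fin L → K) → K[X] := fun c =>
    ∑ j ∈ Finset.range J,
        ((ext c.1 j) ^ (2 * t + 1) + C ε * (ext c.2 j) ^ (2 * t + 1) * F ^ (t + 1)) * X ^ j
  have δ_sub : ∀ c d, δ (c - d) = δ c - δ d := by
    intro c d
    simp only [δ, ← Finset.sum_sub_distrib, Prod.fst_sub, Prod.snd_sub, ext_sub, ← hM,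
      sub_pow_expChar_pow]
    exact Finset.sum_congr rfl fun j _ => by ring
  have δ_deg : ∀ c, (δ c).natDegree < B := by
    intro c
    have : (δ c).natDegree ≤ (L - 1) * (2 * t + 1) + D * (t + 1) + (J - 1) := by
      refine natDegree_sum_le_of_forall_le _ _ fun j hj => ?_
      refine natDegree_mul_le.trans (add_le_add ?_ ?_)
      · refine (natDegree_add_le _ _).trans (max_le ?_ ?_)
        · refine natDegree_pow_le.trans ?_
          have := Nat.mul_le_mul_left (2 * t + 1) (ext_deg c.1 j)
          rw [mul_comm (L - 1)]
          omega
        · refine natDegree_mul_le.trans (add_le_add ?_ ?_)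
          · refine (natDegree_C_mul_le _ _).trans (natDegree_pow_le.trans ?_)
            rw [mul_comm (L - 1)]
            exact Nat.mul_le_mul_left (2 * t + 1) (ext_deg c.2 j)
          · rw [mul_comm D]
            exact natDegree_pow_le
      · rw [natDegree_X_pow]
        have := Finset.mem_range.1 hj
        omega
    omega
  have hcard : Fintype.card (Fin B → K) <
      Fintype.card ((Fin J → Fin L → K) × (Fin J → Fin L → K)) := by
    simp only [Fintype.card_prod, Fintype.card_fun, Fintype.card_fin, ← pow_mul, ← pow_add]
    refine Nat.pow_lt_pow_right Fintype.one_lt_card ?_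
    have h1 : 1 ≤ L := by omega
    have h2 : 2 * t + 1 - D ≤ 2 * L := by omega
    have h3 : D * (t + 2) ≤ D * (2 * L) := Nat.mul_le_mul_left D (by omega)
    rw [hB, hJ]
    clear_value L
    obtain ⟨l, rfl⟩ : ∃ l, L = l + 1 := ⟨L - 1, by omega⟩
    simp only [Nat.add_sub_cancel]
    nlinarith
  obtain ⟨c, d, hne, hcd⟩ := Fintype.exists_ne_map_eq_of_card_lt
    (fun c (i : Fin B) => (δ c).coeff i) hcard
  have hδ : δ (c - d) = 0 := by
    rw [δ_sub, sub_eq_zero]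
    ext i
    by_cases hi : i < B
    · exact congrFun hcd ⟨i, hi⟩
    · rw [coeff_eq_zero_of_natDegree_lt ((δ_deg c).trans_le (not_lt.1 hi)),
        coeff_eq_zero_of_natDegree_lt ((δ_deg d).trans_le (not_lt.1 hi))]
  refine ⟨ext (c - d).1, ext (c - d).2, fun j => ?_, fun j => ?_, ?_, hδ⟩
  · have := ext_deg (c - d).1 j
    omega
  · have := ext_deg (c - d).2 j
    omega
  · by_contra! hz
    refine hne (sub_eq_zero.1 (Prod.ext ?_ ?_))
    · funext j
      have := (hz j j.2).1
      simp only [ext, j.2, dif_pos] at this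
      exact polyOfFn_eq_zero this
    · funext j
      have := (hz j j.2).2
      simp only [ext, j.2, dif_pos] at this
      exact polyOfFn_eq_zero this

theorem card_eval_pow_eq_le {p κ t : ℕ} [ExpChar K p] (hM : p ^ κ = 2 * t + 1)
    (hK : Fintype.card K = (2 * t + 1) ^ 2)
    {F : K[X]} (hF : Squarefree F) (hd : 0 < F.natDegree) (h0 : F.eval 0 ≠ 0)
    (hD : F.natDegree + 1 ≤ t) (ε : K) :
    2 * (Finset.univ.filter fun z : K => F.eval z ^ (Fintype.card K / 2) = ε).card ≤
      Fintype.card K + (1 + 4 * F.natDegree) * (2 * t + 1) := by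
  obtain ⟨u, v, hu, hv, ⟨j₀, hj₀, hne⟩, hδ⟩ := exists_stepanov_family hM hD ε
  set D := F.natDegree with hDdef
  set ψ := ∑ j ∈ Finset.range (t + 1 + D),
    (u j + v j * F ^ (t + 1)) * X ^ (j * (2 * t + 1)) with hψ
  have hψ0 : ψ ≠ 0 := by
    intro h
    have := eq_zero_of_sum_add_mul_pow_mul_X_pow_eq_zero hM hF hd h0 _ u v
      (fun j => by have := hu j; omega) hv h j₀ hj₀
    tauto
  have hdeg : ψ.natDegree ≤ t + D * (t + 1) + (t + D) * (2 * t + 1) := by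
    refine natDegree_sum_le_of_forall_le _ _ fun j hj => ?_
    refine natDegree_mul_le.trans (add_le_add ?_ ?_)
    · refine (natDegree_add_le _ _).trans (max_le ?_ ?_)
      · have := hu j
        omega
      · refine natDegree_mul_le.trans (add_le_add ?_ ?_)
        · have := hv j
          omega
        · rw [mul_comm D]
          exact natDegree_pow_le
    · rw [natDegree_X_pow]
      have := Finset.mem_range.1 hj
      exact Nat.mul_le_mul_right _ (by omega)
  have hsub : (Finset.univ.filter fun z : K => F.eval z ^ (Fintype.card K / 2) = ε).val ⊆
      ψ.roots := by
    intro z hz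
    have hz' : F.eval z ^ (Fintype.card K / 2) = ε := by simpa using hz
    rw [mem_roots hψ0, IsRoot.def]
    refine (pow_eq_zero_iff (n := 2 * t + 1) (by omega)).1 ?_
    have hzK : z ^ ((2 * t + 1) * (2 * t + 1)) = z := by
      rw [← sq, ← hK]; exact FiniteField.pow_card z
    have hexp : (t + 1) * (2 * t + 1) = Fintype.card K / 2 + (t + 1) := by
      rw [hK]
      have : (2 * t + 1) ^ 2 = 2 * (2 * t * t + 2 * t) + 1 := by ring
      rw [this, Nat.mul_add_div (by norm_num)]
      ring_nf
    rw [hψ, eval_finsetSum]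
    have hsp : ∀ f : ℕ → K, (∑ j ∈ Finset.range (t + 1 + D), f j) ^ (2 * t + 1) =
        ∑ j ∈ Finset.range (t + 1 + D), f j ^ (2 * t + 1) := by
      intro f
      rw [← hM]
      exact map_sum (iterateFrobenius K p κ) f _
    rw [hsp]
    have := congrArg (eval z) hδ
    rw [eval_finsetSum, eval_zero] at this
    rw [← this]
    refine Finset.sum_congr rfl fun j _ => ?_
    simp only [eval_mul, eval_add, eval_pow, eval_X, eval_C]
    rw [mul_pow, ← pow_mul z, mul_assoc, mul_comm j, pow_mul, hzK, ← hM, add_pow_expChar_pow, hM,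
      mul_pow, ← pow_mul, hexp, pow_add _ (Fintype.card K / 2), hz']
    ring
  have h1 := (card_le_degree_of_subset_roots hsub).trans hdeg
  have h2 : Fintype.card K = (2 * t + 1) * (2 * t + 1) := by rw [hK, sq]
  nlinarith

/-- A Weil-type bound over large extensions, by Stepanov's method. -/
theorem abs_sum_quadraticChar_eval_le {p κ t : ℕ} [ExpChar K p] (hM : p ^ κ = 2 * t + 1)
    (hK : Fintype.card K = (2 * t + 1) ^ 2)
    {F : K[X]} (hF : Squarefree F) (hd : 0 < F.natDegree) (h0 : F.eval 0 ≠ 0)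
    (hD : F.natDegree + 1 ≤ t) :
    |∑ z : K, quadraticChar K (F.eval z)| ≤ (1 + 5 * F.natDegree) * (2 * t + 1) := by
  have hchar : ringChar K ≠ 2 := by
    intro h
    have h2 := FiniteField.even_card_of_char_two h
    rw [hK] at h2
    have : (2 * t + 1) ^ 2 = 2 * (2 * t * t + 2 * t) + 1 := by ring
    omega
  have hF0 : F ≠ 0 := by rintro rfl; simp at hd
  set N := fun ε : K => (Finset.univ.filter fun z : K =>
    F.eval z ^ (Fintype.card K / 2) = ε).card with hN
  have hb : ∀ ε, 2 * N ε ≤ Fintype.card K + (1 + 4 * F.natDegree) * (2 * t + 1) :=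
    card_eval_pow_eq_le hM hK hF hd h0 hD
  set Z := (Finset.univ.filter fun z : K => F.eval z = 0).card with hZ
  have hZD : Z ≤ F.natDegree := by
    refine card_le_degree_of_subset_roots fun z hz => ?_
    rw [mem_roots hF0]
    simpa using hz
  have hne : (1 : K) ≠ -1 := by
    intro h
    exact Ring.neg_one_ne_one_of_char_ne_two hchar h.symm
  have hpt : ∀ z : K, quadraticChar K (F.eval z) =
      (if F.eval z ^ (Fintype.card K / 2) = 1 then 1 else 0) -
      (if F.eval z ^ (Fintype.card K / 2) = -1 then 1 else 0) ∧
      (1 : ℤ) = (if F.eval z ^ (Fintype.card K / 2) = 1 then 1 else 0) +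
      (if F.eval z ^ (Fintype.card K / 2) = -1 then 1 else 0) +
      (if F.eval z = 0 then 1 else 0) := by
    intro z
    rw [← quadraticChar_eq_pow_of_char_ne_two' hchar]
    by_cases hz : F.eval z = 0
    · simp [hz]
    · rcases quadraticChar_dichotomy hz with h | h <;> simp [h, hz, hne, hne.symm]
  have hsum : ∑ z : K, quadraticChar K (F.eval z) = (N 1 : ℤ) - N (-1) := by
    rw [Finset.sum_congr rfl fun z _ => (hpt z).1, Finset.sum_sub_distrib]
    simp [hN]
  have htot : (Fintype.card K : ℤ) = N 1 + N (-1) + Z := by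
    have : (Fintype.card K : ℤ) = ∑ z : K, (1 : ℤ) := by simp
    rw [this, Finset.sum_congr rfl fun z _ => (hpt z).2, Finset.sum_add_distrib,
      Finset.sum_add_distrib]
    simp [hN, hZ]
  rw [hsum, abs_le]
  have h1 := hb 1
  have h2 := hb (-1)
  zify at h1 h2 hZD
  constructor <;> nlinarith

end Stepanov

section CharacteristicPower

open Polynomial IntermediateField

variable {k L : Type*} [Field k] [Field L] [Algebra k L] [FiniteDimensional k L]

variable (k) in
/-- The characteristic polynomial of `x : L` over `k`, as a power of the minimal polynomial. -/
def minpolyPow (x : L) : k[X] := minpoly k x ^ Module.finrank k⟮x⟯ L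

theorem natDegree_minpoly_mul_finrank (x : L) :
    (minpoly k x).natDegree * Module.finrank k⟮x⟯ L = Module.finrank k L := by
  rw [← adjoin.finrank (.of_finite k x), Module.finrank_mul_finrank]

theorem minpolyPow_monic (x : L) : (minpolyPow k x).Monic :=
  (minpoly.monic (.of_finite k x)).pow _

theorem minpolyPow_natDegree (x : L) : (minpolyPow k x).natDegree = Module.finrank k L := by
  rw [minpolyPow, natDegree_pow, mul_comm, natDegree_minpoly_mul_finrank]

theorem minpolyPow_nextCoeff (x : L) :
    (minpolyPow k x).nextCoeff = -Algebra.trace k L x := by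
  rw [minpolyPow, (minpoly.monic (.of_finite k x)).nextCoeff_pow,
    trace_eq_finrank_mul_minpoly_nextCoeff, nsmul_eq_mul, mul_neg, neg_neg]

theorem minpolyPow_eval (x : L) (a : k) :
    (minpolyPow k x).eval a = Algebra.norm k (algebraMap k L a - x) := by
  have h1 : algebraMap k L a - x =
      algebraMap k⟮x⟯ L (algebraMap k k⟮x⟯ a - AdjoinSimple.gen k x) := by
    rw [map_sub, AdjoinSimple.algebraMap_gen, ← IsScalarTower.algebraMap_apply]
  rw [h1, ← Algebra.norm_norm (S := k⟮x⟯), Algebra.norm_algebraMap, map_pow, minpolyPow, eval_pow]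
  congr 1
  let pb := adjoin.powerBasis (.of_finite k x : IsIntegral k x)
  have h2 : minpoly k x = ((Algebra.leftMulMatrix pb.basis) pb.gen).charpoly := by
    rw [charpoly_leftMulMatrix, adjoin.powerBasis_gen, minpoly_gen]
  rw [h2, Matrix.eval_charpoly, Algebra.norm_eq_matrix_det pb.basis, map_sub,
    AlgHom.commutes, adjoin.powerBasis_gen]
  rfl

variable [Finite k]

theorem card_minpoly_eq [Fintype L] {P : k[X]} (hP : Irreducible P) (hm : P.Monic)
    (hd : P.natDegree ∣ Module.finrank k L) :
    (Finset.univ.filter fun x : L => minpoly k x = P).card = P.natDegree := by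
  have hdvd : P ∣ X ^ (Nat.card k) ^ (Module.finrank k L) - X :=
    hP.natDegree_dvd_iff_dvd_X_pow_card_pow_sub_X.1 hd
  have hcard : Nat.card k ^ Module.finrank k L = Nat.card L :=
    (Module.natCard_eq_pow_finrank (K := k) (V := L)).symm
  rw [hcard] at hdvd
  have hne : (X ^ Nat.card L - X : L[X]) ≠ 0 :=
    FiniteField.X_pow_card_sub_X_ne_zero L Finite.one_lt_card
  have hdvd' : P.map (algebraMap k L) ∣ X ^ Nat.card L - X := by
    have := map_dvd (algebraMap k L) hdvd
    simpa using this
  have hsp' : (X ^ Nat.card L - X : L[X]).Splits := by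
    have := (FiniteField.isSplittingField_sub L k).splits
    simpa [Nat.card_eq_fintype_card] using this
  have hsp : (P.map (algebraMap k L)).Splits :=
    hsp'.of_dvd hne hdvd'
  have hsep : P.Separable := PerfectField.separable_of_irreducible hP
  rw [← card_rootSet_eq_natDegree hsep hsp, ← Set.toFinset_card]
  congr 1
  ext x
  simp only [Finset.mem_filter, Finset.mem_univ, true_and, Set.mem_toFinset, mem_rootSet]
  constructor
  · rintro rfl
    exact ⟨hP.ne_zero, minpoly.aeval k x⟩
  · rintro ⟨-, h⟩
    exact (minpoly.eq_of_irreducible_of_monic hP h hm).symm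

theorem card_minpoly_eq_and_dvd [Fintype L] {P g : k[X]} (hP : Irreducible P) (hm : P.Monic) :
    (Finset.univ.filter fun x : L => minpolyPow k x ∣ g ∧ minpoly k x = P).card =
      if P.natDegree ∣ Module.finrank k L ∧ P ^ (Module.finrank k L / P.natDegree) ∣ g
      then P.natDegree else 0 := by
  have key : ∀ x : L, minpoly k x = P → P.natDegree ∣ Module.finrank k L ∧
      minpolyPow k x = P ^ (Module.finrank k L / P.natDegree) := by
    rintro x rfl
    have := natDegree_minpoly_mul_finrank (k := k) x
    refine ⟨⟨_, this.symm⟩, ?_⟩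
    rw [minpolyPow, ← this, Nat.mul_div_cancel_left _ hP.natDegree_pos]
  split_ifs with h
  · rw [← card_minpoly_eq hP hm h.1]
    congr 1
    ext x
    simp only [Finset.mem_filter, Finset.mem_univ, true_and, and_iff_right_iff_imp]
    intro hx
    rw [(key x hx).2]
    exact h.2
  · rw [Finset.card_eq_zero, Finset.filter_eq_empty_iff]
    rintro x - ⟨h1, h2⟩
    exact h ⟨(key x h2).1, (key x h2).2 ▸ h1⟩

end CharacteristicPower

section CountFactors

open Polynomial UniqueFactorizationMonoid

variable {k : Type*} [Field k]

theorem card_Icc_pow_dvd {P g : k[X]} (hP : Irreducible P) (hm : P.Monic) (hg : g ≠ 0) :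
    ((Finset.Icc 1 g.natDegree).filter fun n => P.natDegree ∣ n ∧ P ^ (n / P.natDegree) ∣ g).card =
      (UniqueFactorizationMonoid.normalizedFactors g).count P := by
  set c := (UniqueFactorizationMonoid.normalizedFactors g).count P with hc
  have hcnt : ∀ j : ℕ, P ^ j ∣ g ↔ j ≤ c := by
    intro j
    rw [pow_dvd_iff_le_emultiplicity,
      UniqueFactorizationMonoid.emultiplicity_eq_count_normalizedFactors hP hg,
      hm.normalize_eq_self]
    exact Nat.cast_le
  have hpos := hP.natDegree_pos
  have : (Finset.Icc 1 g.natDegree).filter (fun n => P.natDegree ∣ n ∧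
      P ^ (n / P.natDegree) ∣ g) = (Finset.Icc 1 c).image fun j => P.natDegree * j := by
    ext n
    simp only [Finset.mem_filter, Finset.mem_Icc, Finset.mem_image, hcnt]
    constructor
    · rintro ⟨⟨h1, h2⟩, ⟨j, rfl⟩, h3⟩
      rw [Nat.mul_div_cancel_left _ hpos] at h3
      refine ⟨j, ⟨?_, h3⟩, rfl⟩
      rcases Nat.eq_zero_or_pos j with rfl | h
      · simp at h1
      · exact h
    · rintro ⟨j, ⟨h1, h2⟩, rfl⟩
      refine ⟨⟨Nat.mul_pos hpos h1, ?_⟩, dvd_mul_right _ _, ?_⟩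
      · have := natDegree_le_of_dvd ((hcnt j).2 h2) hg
        rwa [natDegree_pow, mul_comm] at this
      · rwa [Nat.mul_div_cancel_left _ hpos]
  rw [this, Finset.card_image_of_injective _ fun a b h => Nat.eq_of_mul_eq_mul_left hpos h]
  simp

theorem sum_natDegree_mul_count {g : k[X]} (hg : g.Monic) :
    ∑ P ∈ (normalizedFactors g).toFinset, P.natDegree * (normalizedFactors g).count P =
      g.natDegree := by
  conv_rhs => rw [← hg.normalize_eq_self, ← prod_normalizedFactors_eq hg.ne_zero]
  rw [natDegree_multiset_prod_of_monic, Finset.sum_multiset_map_count]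
  · exact Finset.sum_congr rfl fun P _ => by rw [smul_eq_mul, mul_comm]
  · intro P hP
    rw [← normalize_normalized_factor P hP]
    exact monic_normalize (irreducible_of_normalized_factor P hP).ne_zero

theorem sum_card_minpolyPow_dvd [Finite k] (L : ℕ → Type*) [∀ n, Field (L n)]
    [∀ n, Algebra k (L n)] [∀ n, FiniteDimensional k (L n)] [∀ n, Fintype (L n)]
    (hL : ∀ n, n ≠ 0 → Module.finrank k (L n) = n) {g : k[X]} (hg : g.Monic) :
    ∑ n ∈ Finset.Icc 1 g.natDegree,
      (Finset.univ.filter fun x : L n => minpolyPow k x ∣ g).card = g.natDegree := by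
  have hmon : ∀ P ∈ (normalizedFactors g).toFinset, P.Monic := by
    intro P hP
    rw [Multiset.mem_toFinset] at hP
    rw [← normalize_normalized_factor P hP]
    exact monic_normalize (irreducible_of_normalized_factor P hP).ne_zero
  have hirr : ∀ P ∈ (normalizedFactors g).toFinset, Irreducible P := fun P hP =>
    irreducible_of_normalized_factor P (Multiset.mem_toFinset.1 hP)
  have h1 : ∀ n ∈ Finset.Icc 1 g.natDegree,
      (Finset.univ.filter fun x : L n => minpolyPow k x ∣ g).card =
      ∑ P ∈ (normalizedFactors g).toFinset,
        if P.natDegree ∣ n ∧ P ^ (n / P.natDegree) ∣ g then P.natDegree else 0 := by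
    intro n hn
    have hn0 : n ≠ 0 := by have := (Finset.mem_Icc.1 hn).1; omega
    rw [Finset.card_eq_sum_card_fiberwise (f := fun x => minpoly k x)
      (t := (normalizedFactors g).toFinset)]
    · refine Finset.sum_congr rfl fun P hP => ?_
      have := card_minpoly_eq_and_dvd (L := L n) (g := g) (hirr P hP) (hmon P hP)
      rw [hL n hn0] at this
      rw [← this, Finset.filter_filter]
    · intro x hx
      have hx' : minpolyPow k x ∣ g := by simpa using hx
      have hi := minpoly.irreducible (IsIntegral.of_finite k x)
      rw [Finset.mem_coe, Multiset.mem_toFinset, mem_normalizedFactors_iff' hg.ne_zero]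
      refine ⟨hi, (minpoly.monic (.of_finite k x)).normalize_eq_self, ?_⟩
      exact (dvd_pow_self _ Module.finrank_pos.ne').trans hx'
  rw [Finset.sum_congr rfl h1, Finset.sum_comm, ← sum_natDegree_mul_count hg]
  refine Finset.sum_congr rfl fun P hP => ?_
  rw [← card_Icc_pow_dvd (hirr P hP) (hmon P hP) hg.ne_zero, ← Finset.sum_filter,
    Finset.sum_const, smul_eq_mul, mul_comm, sum_natDegree_mul_count hg]

end CountFactors

section PowerSums

open Polynomial

theorem exists_multiset_prod_one_sub_C_mul_X {E : ℂ[X]} (h0 : E.coeff 0 = 1) :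
    ∃ ω : Multiset ℂ, ω.card ≤ E.natDegree ∧ E = (ω.map fun w => 1 - C w * X).prod := by
  have hE : E ≠ 0 := by rintro rfl; simp at h0
  have hroots : ∀ r ∈ E.roots, r ≠ 0 := by
    rintro r hr rfl
    rw [mem_roots hE, IsRoot.def, ← coeff_zero_eq_eval_zero, h0] at hr
    exact one_ne_zero hr
  refine ⟨E.roots.map fun r => r⁻¹, ?_, ?_⟩
  · rw [Multiset.card_map]; exact card_roots' E
  · have hs := (IsAlgClosed.splits E).eq_prod_roots
    have h1 : (E.roots.map fun r => X - C r).prod =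
        (E.roots.map fun r => C (-r)).prod * (E.roots.map fun r => 1 - C r⁻¹ * X).prod := by
      rw [← Multiset.prod_map_mul]
      congr 1
      refine Multiset.map_congr rfl fun r hr => ?_
      rw [mul_sub, ← mul_assoc, ← C_mul, mul_one, neg_mul, mul_inv_cancel₀ (hroots r hr)]
      simp only [C_neg, C_1]
      ring
    rw [h1, ← mul_assoc] at hs
    have h2 : C E.leadingCoeff * (E.roots.map fun r => C (-r)).prod = 1 := by
      have h3 : (E.roots.map fun r => C (-r)).prod = C (E.roots.map fun r => -r).prod := by
        rw [map_multiset_prod, Multiset.map_map]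
        rfl
      have h4 := congrArg (eval 0) hs
      rw [h3, ← C_mul, eval_mul, eval_C, ← coeff_zero_eq_eval_zero, h0, eval_multiset_prod,
        Multiset.map_map] at h4
      rw [h3, ← C_mul]
      simp only [Function.comp_def, eval_sub, eval_one, eval_mul, eval_C, eval_X, mul_zero,
        sub_zero, Multiset.map_const', Multiset.prod_replicate, one_pow, mul_one] at h4
      rw [← h4, C_1]
    rw [h2, one_mul] at hs
    rwa [Multiset.map_map]

theorem X_mul_derivative_prod_one_sub (ω : Multiset ℂ) :
    ((X * derivative (ω.map fun w => 1 - C w * X).prod : ℂ[X]) : PowerSeries ℂ) =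
      -(((ω.map fun w => 1 - C w * X).prod : ℂ[X]) : PowerSeries ℂ) *
        PowerSeries.mk fun n => if n = 0 then 0 else (ω.map fun w => w ^ n).sum := by
  induction ω using Multiset.induction with
  | empty =>
    have : (PowerSeries.mk fun _ : ℕ => (0 : ℂ)) = 0 := by
      ext n; simp
    simp [this]
  | cons w ω ih =>
    simp only [Multiset.map_cons, Multiset.prod_cons, Multiset.sum_cons]
    have hU : (PowerSeries.mk fun n => if n = 0 then 0 else w ^ n + (ω.map fun w => w ^ n).sum) =
        (PowerSeries.mk fun n => if n = 0 then 0 else w ^ n) +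
        PowerSeries.mk fun n => if n = 0 then 0 else (ω.map fun w => w ^ n).sum := by
      ext n
      by_cases hn : n = 0 <;> simp [hn]
    have hgeo : (1 - PowerSeries.C w * PowerSeries.X) *
        (PowerSeries.mk fun n => if n = 0 then 0 else w ^ n) = PowerSeries.C w * PowerSeries.X := by
      ext n
      rw [sub_mul, one_mul, mul_assoc, map_sub, PowerSeries.coeff_C_mul, PowerSeries.coeff_C_mul]
      rcases n with _ | n
      · simp
      · rw [PowerSeries.coeff_succ_X_mul, PowerSeries.coeff_X, PowerSeries.coeff_mk,
          PowerSeries.coeff_mk]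
        rcases n with _ | n
        · simp
        · simp [pow_succ']
    rw [hU]
    set E := (ω.map fun w => 1 - C w * X).prod
    have hd : X * derivative ((1 - C w * X) * E) =
        (1 - C w * X) * (X * derivative E) - C w * X * E := by
      simp only [derivative_mul, derivative_sub, derivative_one, derivative_C, derivative_X]
      ring
    rw [hd, coe_sub, coe_mul (1 - C w * X) (X * _), ih]
    simp only [coe_mul, coe_sub, coe_one, coe_C, coe_X]
    linear_combination (E : PowerSeries ℂ) * hgeo

/-- Newton-type recurrences identify a sequence as (negated) power sums. -/
theorem exists_multiset_eq_neg_sum_pow {c s : ℕ → ℂ} {d : ℕ} (h0 : c 0 = 1)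
    (hc : ∀ n, d < n → c n = 0)
    (hs : ∀ n : ℕ, (n : ℂ) * c n = ∑ m ∈ Finset.Icc 1 n, s m * c (n - m)) :
    ∃ ω : Multiset ℂ, ω.card ≤ d ∧ ∀ n, n ≠ 0 → s n = -(ω.map fun w => w ^ n).sum := by
  set E : ℂ[X] := ∑ i ∈ Finset.range (d + 1), C (c i) * X ^ i with hE
  have hcoeff : ∀ n, E.coeff n = c n := by
    intro n
    simp only [hE, finsetSum_coeff, coeff_C_mul_X_pow]
    rw [Finset.sum_ite_eq]
    split_ifs with h
    · rfl
    · exact (hc n (by simpa using h)).symm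
  obtain ⟨ω, hω, hprod⟩ := exists_multiset_prod_one_sub_C_mul_X (by rw [hcoeff, h0] : E.coeff 0 = 1)
  have hdeg : E.natDegree ≤ d :=
    natDegree_sum_le_of_forall_le _ _ fun i hi =>
      (natDegree_C_mul_X_pow_le _ _).trans (by have := Finset.mem_range.1 hi; omega)
  refine ⟨ω, hω.trans hdeg, ?_⟩
  have h1 := X_mul_derivative_prod_one_sub ω
  rw [← hprod] at h1
  have h2 : ((X * derivative E : ℂ[X]) : PowerSeries ℂ) =
      (E : PowerSeries ℂ) * PowerSeries.mk fun n => if n = 0 then 0 else s n := by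
    ext n
    rw [mul_comm (E : PowerSeries ℂ), PowerSeries.coeff_mul, coeff_coe,
      Finset.Nat.sum_antidiagonal_eq_sum_range_succ
      (fun i j => PowerSeries.coeff i (PowerSeries.mk fun n => if n = 0 then 0 else s n) *
        PowerSeries.coeff j (E : PowerSeries ℂ))]
    simp only [PowerSeries.coeff_mk, coeff_coe, hcoeff]
    rw [Finset.sum_range_succ', if_pos rfl, zero_mul, add_zero]
    have h3 : (X * derivative E).coeff n = n * c n := by
      rcases n with _ | n
      · simp
      · rw [coeff_X_mul, coeff_derivative, hcoeff]
        push_cast; ring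
    rw [h3, hs, Finset.range_eq_Ico, Finset.sum_Ico_add' (fun i => (if i = 0 then 0 else s i) *
      c (n - i)) 0 n 1]
    refine Finset.sum_congr rfl fun m hm => ?_
    have := (Finset.mem_Ico.1 hm).1
    rw [if_neg (by omega)]
  have hE0 : (E : PowerSeries ℂ) ≠ 0 := by
    intro h
    have := hcoeff 0
    rw [← coeff_coe, h, h0] at this
    simp at this
  have h3 : (PowerSeries.mk fun n => if n = 0 then 0 else s n) =
      -PowerSeries.mk fun n => if n = 0 then 0 else (ω.map fun w => w ^ n).sum := by
    refine mul_left_cancel₀ hE0 ?_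
    rw [← h2, h1]; ring
  intro n hn
  have := congrArg (PowerSeries.coeff n) h3
  simpa [hn] using this

end PowerSums

section LFunction

open Polynomial

variable {k : Type*} [Field k] [Fintype k]

variable (k) in
/-- Monic polynomials of degree `n` over a finite field. -/
def monics (n : ℕ) : Finset k[X] :=
  Finset.univ.image fun c : Fin n → k => X ^ n + ∑ i, C (c i) * X ^ (i : ℕ)

theorem mem_monics {n : ℕ} {g : k[X]} : g ∈ monics k n ↔ g.Monic ∧ g.natDegree = n := by
  simp only [monics, Finset.mem_image, Finset.mem_univ, true_and]
  constructor
  · rintro ⟨c, rfl⟩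
    have hlt : (∑ i, C (c i) * X ^ (i : ℕ) : k[X]).degree < n := by
      refine (degree_sum_le _ _).trans_lt ?_
      refine (Finset.sup_lt_iff (WithBot.bot_lt_coe n)).2 fun i _ => ?_
      exact (degree_C_mul_X_pow_le _ _).trans_lt (Nat.cast_lt.2 i.2)
    refine ⟨monic_X_pow_add hlt, ?_⟩
    rw [natDegree_add_eq_left_of_degree_lt (by rwa [degree_X_pow]), natDegree_X_pow]
  · rintro ⟨hm, rfl⟩
    refine ⟨fun i => g.coeff i, ?_⟩
    conv_rhs => rw [hm.as_sum]
    rw [Finset.sum_range]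

/-- The completely multiplicative function on monic polynomials attached to a quadratic character
of `∏ a ∈ A, (X - a)` and an additive character. -/
def lam (ψ : AddChar k ℂ) (A : Finset k) (g : k[X]) : ℂ :=
  (quadraticChar k (∏ a ∈ A, g.eval a) : ℂ) * ψ (-g.nextCoeff)

theorem lam_mul (ψ : AddChar k ℂ) (A : Finset k) {f g : k[X]} (hf : f.Monic) (hg : g.Monic) :
    lam ψ A (f * g) = lam ψ A f * lam ψ A g := by
  simp only [lam, eval_mul, Finset.prod_mul_distrib, map_mul, hf.nextCoeff_mul hg, neg_add,
    AddChar.map_add_eq_mul]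
  push_cast
  ring

theorem sum_lam_eq_zero (hk : ringChar k ≠ 2) (ψ : AddChar k ℂ) {A : Finset k} (hA : A.Nonempty)
    {n : ℕ} (hn : A.card < n) : ∑ g ∈ monics k n, lam ψ A g = 0 := by
  obtain ⟨a₀, ha₀⟩ := hA
  set P : k[X] := ∏ a ∈ A.erase a₀, (X - C a) with hP
  have hPdeg : P.natDegree + 1 = A.card := by
    rw [hP, natDegree_finsetProd_X_sub_C_eq_card, Finset.card_erase_add_one ha₀]
  have hP0 : P.eval a₀ ≠ 0 := by
    rw [hP, eval_prod, Finset.prod_ne_zero_iff]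
    intro a ha
    simp only [eval_sub, eval_X, eval_C]
    exact sub_ne_zero.2 (Finset.ne_of_mem_erase ha).symm
  have hPA : ∀ a ∈ A.erase a₀, P.eval a = 0 := by
    intro a ha
    rw [hP, eval_prod]
    exact Finset.prod_eq_zero ha (by simp)
  have hPlt : ∀ s : k, (C s * P).natDegree < n - 1 := fun s =>
    (natDegree_C_mul_le _ _).trans_lt (by omega)
  have hmem : ∀ (s : k), ∀ g ∈ monics k n, g + C s * P ∈ monics k n := by
    intro s g hg
    rw [mem_monics] at hg ⊢
    have hlt : (C s * P).natDegree < g.natDegree := by have := hPlt s; omega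
    refine ⟨hg.1.add_of_left (degree_lt_degree hlt), ?_⟩
    rw [natDegree_add_eq_left_of_natDegree_lt hlt, hg.2]
  have hnext : ∀ (s : k), ∀ g ∈ monics k n, (g + C s * P).nextCoeff = g.nextCoeff := by
    intro s g hg
    have h1 := (mem_monics.1 hg).2
    have h2 := (mem_monics.1 (hmem s g hg)).2
    rw [nextCoeff_of_natDegree_pos (by omega), nextCoeff_of_natDegree_pos (by omega), h1, h2,
      coeff_add, coeff_eq_zero_of_natDegree_lt (hPlt s), add_zero]
  have hshift : ∀ s : k, ∑ g ∈ monics k n, lam ψ A g = ∑ g ∈ monics k n, lam ψ A (g + C s * P) := by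
    intro s
    refine Finset.sum_nbij' (fun g => g - C s * P) (fun g => g + C s * P) ?_ (hmem s) ?_ ?_ ?_
    · intro g hg
      have := hmem (-s) g hg
      rwa [C_neg, neg_mul, ← sub_eq_add_neg] at this
    · intro g _; simp
    · intro g _; simp
    · intro g _; simp
  have hzero : ∀ g ∈ monics k n, ∑ s : k, lam ψ A (g + C s * P) = 0 := by
    intro g hg
    set w := ∏ a ∈ A.erase a₀, g.eval a
    have h1 : ∀ s : k, lam ψ A (g + C s * P) =
        (quadraticChar k w : ℂ) * ψ (-g.nextCoeff) *
          (quadraticChar k (g.eval a₀ + s * P.eval a₀) : ℂ) := by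
      intro s
      rw [lam, hnext s g hg, ← Finset.mul_prod_erase A _ ha₀, map_mul]
      have : ∏ a ∈ A.erase a₀, eval a (g + C s * P) = w :=
        Finset.prod_congr rfl fun a ha => by simp [hPA a ha]
      rw [this]
      simp only [eval_add, eval_mul, eval_C]
      push_cast
      ring
    rw [Finset.sum_congr rfl fun s _ => h1 s, ← Finset.mul_sum]
    have h2 : ∑ s : k, quadraticChar k (g.eval a₀ + s * P.eval a₀) = ∑ s : k, quadraticChar k s :=
      Fintype.sum_equiv ((Equiv.mulRight₀ _ hP0).trans (Equiv.addLeft (g.eval a₀))) _ _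
        fun s => by simp
    rw [quadraticChar_sum_zero hk] at h2
    have h3 : (∑ s : k, (quadraticChar k (g.eval a₀ + s * P.eval a₀) : ℂ)) = 0 := by
      exact_mod_cast h2
    rw [h3, mul_zero]
  have htot : ∑ s : k, ∑ g ∈ monics k n, lam ψ A g = 0 := by
    rw [Finset.sum_congr rfl fun s _ => hshift s, Finset.sum_comm]
    exact Finset.sum_eq_zero hzero
  rw [Finset.sum_const, nsmul_eq_mul, mul_eq_zero] at htot
  refine htot.resolve_left ?_
  simp

variable (L : ℕ → Type*) [∀ n, Field (L n)]
    [∀ n, Algebra k (L n)] [∀ n, FiniteDimensional k (L n)] [∀ n, Fintype (L n)]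

theorem natCast_mul_sum_lam (hL : ∀ n, n ≠ 0 → Module.finrank k (L n) = n)
    (ψ : AddChar k ℂ) (A : Finset k) (n : ℕ) :
    (n : ℂ) * ∑ g ∈ monics k n, lam ψ A g =
      ∑ m ∈ Finset.Icc 1 n, (∑ x : L m, lam ψ A (minpolyPow k x)) *
        ∑ g ∈ monics k (n - m), lam ψ A g := by
  have h1 : ∀ g ∈ monics k n, (n : ℂ) * lam ψ A g =
      ∑ m ∈ Finset.Icc 1 n, ∑ x : L m, if minpolyPow k x ∣ g then lam ψ A g else 0 := by
    intro g hg
    obtain ⟨hm, hd⟩ := mem_monics.1 hg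
    have := sum_card_minpolyPow_dvd L hL hm
    rw [hd] at this
    conv_lhs => rw [← this]
    push_cast
    rw [Finset.sum_mul]
    refine Finset.sum_congr rfl fun m _ => ?_
    rw [← Finset.sum_filter, Finset.sum_const, nsmul_eq_mul]
  rw [Finset.mul_sum, Finset.sum_congr rfl h1, Finset.sum_comm]
  refine Finset.sum_congr rfl fun m hm => ?_
  obtain ⟨hm1, hmn⟩ := Finset.mem_Icc.1 hm
  rw [Finset.sum_comm, Finset.sum_mul]
  refine Finset.sum_congr rfl fun x _ => ?_
  have hmon := minpolyPow_monic (k := k) x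
  have hdeg := minpolyPow_natDegree (k := k) x
  rw [hL m (by omega)] at hdeg
  rw [← Finset.sum_filter, Finset.mul_sum]
  symm
  refine Finset.sum_bij (fun g _ => minpolyPow k x * g) ?_ ?_ ?_ ?_
  · intro g hg
    obtain ⟨h1, h2⟩ := mem_monics.1 hg
    rw [Finset.mem_filter, mem_monics]
    refine ⟨⟨hmon.mul h1, ?_⟩, dvd_mul_right _ _⟩
    rw [hmon.natDegree_mul h1, hdeg, h2]; omega
  · intro g _ g' _ h
    exact mul_left_cancel₀ hmon.ne_zero h
  · intro g hg
    rw [Finset.mem_filter, mem_monics] at hg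
    obtain ⟨⟨h1, h2⟩, g', rfl⟩ := hg
    have h3 : g'.Monic := hmon.of_mul_monic_left h1
    refine ⟨g', ?_, rfl⟩
    rw [mem_monics]
    refine ⟨h3, ?_⟩
    rw [hmon.natDegree_mul h3, hdeg] at h2
    omega
  · intro g hg
    rw [lam_mul ψ A hmon (mem_monics.1 hg).1]

/-- The character sums over the extensions of `k` are negated power sums of few numbers. -/
theorem exists_multiset_sum_lam_eq (hk : ringChar k ≠ 2)
    (hL : ∀ n, n ≠ 0 → Module.finrank k (L n) = n)
    (ψ : AddChar k ℂ) {A : Finset k} (hA : A.Nonempty) :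
    ∃ ω : Multiset ℂ, ω.card ≤ A.card ∧ ∀ n, n ≠ 0 →
      ∑ x : L n, lam ψ A (minpolyPow k x) = -(ω.map fun w => w ^ n).sum := by
  refine exists_multiset_eq_neg_sum_pow (c := fun n => ∑ g ∈ monics k n, lam ψ A g) ?_
    (fun n hn => sum_lam_eq_zero hk ψ hA hn) (natCast_mul_sum_lam L hL ψ A)
  have : monics k 0 = {1} := by
    ext g
    rw [mem_monics, Finset.mem_singleton]
    constructor
    · rintro ⟨h1, h2⟩
      exact h1.natDegree_eq_zero.1 h2
    · rintro rfl
      simp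
  have h1 : (1 : k[X]).nextCoeff = 0 := nextCoeff_C_eq_zero 1
  simp [this, lam, h1]

end LFunction

section NormTrace

open Polynomial

variable {k L : Type*} [Field k] [Field L] [Fintype k] [Algebra k L]

variable (k L) in
/-- The map `z ↦ z ^ q - z`, where `q` is the cardinality of the base field. -/
def frobeniusSub : L →ₗ[k] L := (FiniteField.frobeniusAlgHom k L).toLinearMap - LinearMap.id

theorem frobeniusSub_apply (z : L) : frobeniusSub k L z = z ^ Fintype.card k - z := rfl

theorem ker_frobeniusSub : (frobeniusSub k L).ker = 1 := by
  ext z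
  rw [LinearMap.mem_ker, frobeniusSub_apply, Submodule.mem_one, sub_eq_zero]
  have hinj := (algebraMap k L).injective
  have hq := Fintype.one_lt_card (α := k)
  constructor
  · intro hz
    by_contra! hne
    have hp : (X ^ Fintype.card k - X : L[X]) ≠ 0 := FiniteField.X_pow_card_sub_X_ne_zero L hq
    have hsub : insert z (Finset.univ.image (algebraMap k L)) ⊆
        (X ^ Fintype.card k - X : L[X]).roots.toFinset := by
      intro w hw
      rw [Multiset.mem_toFinset, mem_roots hp, IsRoot.def, eval_sub, eval_pow, eval_X, sub_eq_zero]
      rcases Finset.mem_insert.1 hw with rfl | hw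
      · exact hz
      · obtain ⟨y, -, rfl⟩ := Finset.mem_image.1 hw
        rw [← map_pow, FiniteField.pow_card]
    have h1 := (Finset.card_le_card hsub).trans ((Multiset.toFinset_card_le _).trans (card_roots' _))
    rw [FiniteField.X_pow_card_sub_X_natDegree_eq L hq, Finset.card_insert_of_notMem,
      Finset.card_image_of_injective _ hinj, Finset.card_univ] at h1
    · omega
    · simpa using fun x => hne x
  · rintro ⟨y, rfl⟩
    rw [← map_pow, FiniteField.pow_card]

variable [Fintype L]

theorem quadraticChar_norm (hk : ringChar k ≠ 2) (y : L) :
    quadraticChar k (Algebra.norm k y) = quadraticChar L y := by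
  have hL : ringChar L ≠ 2 := by rwa [← Algebra.ringChar_eq k L]
  refine Int.cast_injOn_of_ringChar_ne_two (R := L) hL (quadraticChar_isQuadratic k _)
    (quadraticChar_isQuadratic L y) ?_
  have h1 := congrArg (algebraMap k L) (quadraticChar_eq_pow_of_char_ne_two' hk (Algebra.norm k y))
  rw [map_intCast, map_pow, FiniteField.algebraMap_norm_eq_pow] at h1
  rw [h1, quadraticChar_eq_pow_of_char_ne_two' hL y, ← pow_mul, Nat.card_eq_fintype_card,
    Nat.card_eq_fintype_card]
  congr 1
  have hdvd : Fintype.card k - 1 ∣ Fintype.card L - 1 := by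
    rw [Module.card_eq_pow_finrank (K := k) (V := L)]
    simpa using Nat.sub_dvd_pow_sub_pow (Fintype.card k) 1 (Module.finrank k L)
  obtain ⟨m, hm⟩ := hdvd
  have hk2 := FiniteField.odd_card_of_char_ne_two hk
  have hL2 := FiniteField.odd_card_of_char_ne_two hL
  have hk1 := Fintype.one_lt_card (α := k)
  rw [hm, Nat.mul_div_cancel_left _ (by omega)]
  set q := Fintype.card k
  set Q := Fintype.card L
  have hq : q - 1 = 2 * (q / 2) := by omega
  have hQ : Q - 1 = 2 * (Q / 2) := by omega
  rw [hq, hQ] at hm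
  nlinarith

theorem lam_minpolyPow (hk : ringChar k ≠ 2) (ψ : AddChar k ℂ) {A : Finset k} (hA : Even A.card)
    (x : L) :
    lam ψ A (minpolyPow k x) =
      (quadraticChar L (∏ a ∈ A, (x - algebraMap k L a)) : ℂ) * ψ (Algebra.trace k L x) := by
  have : ∏ a ∈ A, (x - algebraMap k L a) = ∏ a ∈ A, (algebraMap k L a - x) := by
    rw [← one_mul (∏ a ∈ A, (algebraMap k L a - x)), ← hA.neg_one_pow, ← Finset.prod_const,
      ← Finset.prod_mul_distrib]
    exact Finset.prod_congr rfl fun a _ => by ring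
  simp only [lam, minpolyPow_nextCoeff, neg_neg, minpolyPow_eval]
  rw [← map_prod, quadraticChar_norm hk, this]

theorem range_frobeniusSub : (frobeniusSub k L).range = (Algebra.trace k L).ker := by
  have h1 := LinearMap.finrank_range_add_finrank_ker (frobeniusSub k L)
  have h2 := LinearMap.finrank_range_add_finrank_ker (Algebra.trace k L)
  rw [LinearMap.range_eq_top.2 (Algebra.trace_surjective k L), finrank_top, Module.finrank_self] at h2
  have h3 : Module.finrank k (frobeniusSub k L).ker = 1 := by
    rw [ker_frobeniusSub, Submodule.one_eq_span]
    exact finrank_span_singleton one_ne_zero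
  refine Submodule.eq_of_le_of_finrank_eq ?_ (by omega)
  rintro _ ⟨z, rfl⟩
  rw [LinearMap.mem_ker, frobeniusSub_apply, map_sub, sub_eq_zero]
  have hb := Algebra.trace_eq_of_algEquiv
    (AlgEquiv.ofBijective (FiniteField.frobeniusAlgHom k L)
      ((FiniteField.frobeniusAlgHom k L).bijective)) z
  exact hb

theorem card_frobeniusSub_fiber {x : L} (hx : Algebra.trace k L x = 0) :
    (Finset.univ.filter fun z => frobeniusSub k L z = x).card = Fintype.card k := by
  have hx' : x ∈ Set.range (frobeniusSub k L) := by
    have : x ∈ (frobeniusSub k L).range := by rwa [range_frobeniusSub, LinearMap.mem_ker]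
    exact this
  rw [AddMonoidHom.card_fiber_eq_of_mem_range (frobeniusSub k L) hx' ⟨0, map_zero _⟩,
    ← Finset.card_univ, ← Finset.card_image_of_injective _ (algebraMap k L).injective]
  congr 1
  ext z
  have : z ∈ (frobeniusSub k L).ker ↔ z ∈ (1 : Submodule k L) := by rw [ker_frobeniusSub]
  rw [LinearMap.mem_ker, Submodule.mem_one] at this
  simpa using this

theorem sum_comp_frobeniusSub (f : L → ℂ) {ψ : AddChar k ℂ} (hψ : ψ.IsPrimitive) :
    ∑ b : k, ∑ x : L, f x * ψ (b * Algebra.trace k L x) =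
      ∑ z : L, f (z ^ Fintype.card k - z) := by
  rw [Finset.sum_comm]
  have h1 : ∀ x : L, ∑ b : k, f x * ψ (b * Algebra.trace k L x) =
      ∑ z ∈ Finset.univ.filter (fun z => frobeniusSub k L z = x), f (frobeniusSub k L z) := by
    intro x
    rw [← Finset.mul_sum, AddChar.sum_mulShift _ hψ]
    rw [Finset.sum_congr rfl (g := fun _ => f x) fun z hz => by rw [(Finset.mem_filter.1 hz).2],
      Finset.sum_const, nsmul_eq_mul, mul_comm]
    split_ifs with hx
    · rw [card_frobeniusSub_fiber hx]
    · rw [Finset.filter_eq_empty_iff.2]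
      · simp
      · rintro z - rfl
        have : frobeniusSub k L z ∈ (frobeniusSub k L).range := ⟨z, rfl⟩
        rw [range_frobeniusSub] at this
        exact hx this
  rw [Finset.sum_congr rfl fun x _ => h1 x]
  exact Finset.sum_fiberwise Finset.univ (frobeniusSub k L) fun z => f (frobeniusSub k L z)

end NormTrace

section ArtinSchreier

open Polynomial

variable {k L : Type*} [Field k] [Field L] [Fintype k] [Fintype L] [Algebra k L]

theorem abs_sum_quadraticChar_artinSchreier_le {p κ : ℕ} (hp : p.Prime) (hp2 : Odd p)
    (hk : Fintype.card k = p) (hL : Fintype.card L = p ^ (2 * κ)) {A : Finset k}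
    (hA : A.Nonempty) (h0 : (0 : k) ∉ A) (hκ : 2 * (p * A.card + 1) + 1 ≤ p ^ κ) :
    |∑ z : L, quadraticChar L (∏ a ∈ A, (z ^ p - z - algebraMap k L a))| ≤
      (1 + 5 * (p * A.card : ℕ)) * (p ^ κ : ℕ) := by
  have : Fact p.Prime := ⟨hp⟩
  have : CharP k p := charP_of_card_eq_prime hk
  have : CharP L p := charP_of_injective_algebraMap (algebraMap k L).injective p
  have : ExpChar L p := ExpChar.prime hp
  obtain ⟨t, ht⟩ := hp2.pow (n := κ)
  set G : L[X] := ∏ a ∈ A, (X - C (algebraMap k L a)) with hG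
  set P : L[X] := X ^ p - X with hP
  have hdegP : P.natDegree = p := FiniteField.X_pow_card_sub_X_natDegree_eq L hp.one_lt
  have hdegG : G.natDegree = A.card := by
    rw [hG, natDegree_prod_of_monic _ _ fun a _ => monic_X_sub_C _]
    simp
  have hdeg : (G.comp P).natDegree = p * A.card := by
    rw [natDegree_comp, hdegG, hdegP, mul_comm]
  have hsepG : G.Separable :=
    separable_prod_X_sub_C_iff'.2 fun _ _ _ _ h => (algebraMap k L).injective h
  have hsq : Squarefree (G.comp P) := by
    refine Separable.squarefree ?_
    have hd : derivative P = -1 := by simp [hP, derivative_X_pow, CharP.cast_eq_zero]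
    rw [Polynomial.separable_def, derivative_comp, hd]
    have := (Polynomial.separable_def _).1 hsepG |>.map (compRingHom P)
    simp only [coe_compRingHom_apply] at this
    simpa using this.neg_right
  have heval : ∀ z, (G.comp P).eval z = ∏ a ∈ A, (z ^ p - z - algebraMap k L a) := by
    intro z
    simp [hG, hP, eval_comp, eval_prod]
  have := abs_sum_quadraticChar_eval_le (t := t) (κ := κ) ht
    (by rw [hL, ← ht, ← pow_mul, mul_comm]) hsq
    (by rw [hdeg]; exact Nat.mul_pos hp.pos hA.card_pos)
    (by
      rw [heval, Finset.prod_ne_zero_iff]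
      intro a ha
      rw [zero_pow hp.ne_zero, sub_zero, zero_sub, neg_ne_zero, _root_.map_ne_zero]
      rintro rfl
      exact h0 ha)
    (by rw [hdeg]; omega)
  rw [hdeg] at this
  simp only [heval] at this
  rw [ht]
  exact_mod_cast this

end ArtinSchreier

section PowerSumRadius

open Filter Topology

theorem exists_ge_forall_half_le_re_pow {ι : Type*} [Fintype ι] (u : ι → ℂ) (hu : ∀ i, ‖u i‖ = 1)
    (n : ℕ) : ∃ m ≥ n, ∀ i, (1 / 2 : ℝ) ≤ ((u i) ^ m).re := by
  have hK : IsCompact (Metric.closedBall (0 : ι → ℂ) 1) := isCompact_closedBall _ _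
  have hx : ∀ j : ℕ, (fun i => u i ^ j) ∈ Metric.closedBall (0 : ι → ℂ) 1 := by
    intro j
    rw [mem_closedBall_zero_iff, pi_norm_le_iff_of_nonneg zero_le_one]
    intro i
    rw [norm_pow, hu, one_pow]
  obtain ⟨a, -, φ, hφ, hlim⟩ := hK.tendsto_subseq hx
  obtain ⟨N, hN⟩ := Metric.cauchySeq_iff.1 hlim.cauchySeq (1 / 2) (by norm_num)
  have hid : N + φ N + n + 1 ≤ φ (N + φ N + n + 1) := hφ.id_le _
  refine ⟨φ (N + φ N + n + 1) - φ N, by omega, fun i => ?_⟩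
  · have hlt : φ N ≤ φ (N + φ N + n + 1) := hφ.monotone (by omega)
    have h1 := hN (N + φ N + n + 1) (by omega) N le_rfl
    rw [dist_pi_lt_iff (by norm_num)] at h1
    have h2 := h1 i
    simp only [Function.comp_apply, dist_eq_norm] at h2
    have h3 : u i ^ φ (N + φ N + n + 1) - u i ^ φ N =
        u i ^ φ N * (u i ^ (φ (N + φ N + n + 1) - φ N) - 1) := by
      rw [mul_sub, ← pow_add, mul_one, Nat.add_sub_cancel' hlt]
    rw [h3, norm_mul, norm_pow, hu, one_pow, one_mul] at h2
    have h4 := (Complex.abs_re_le_norm (u i ^ (φ (N + φ N + n + 1) - φ N) - 1))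
    rw [Complex.sub_re, Complex.one_re] at h4
    have := abs_le.1 (h4.trans h2.le)
    linarith

theorem norm_le_of_norm_sum_pow_le {ω : Multiset ℂ} {C B : ℝ} (hB : 0 < B) {n₀ : ℕ}
    (h : ∀ n ≥ n₀, ‖(ω.map fun w => w ^ n).sum‖ ≤ C * B ^ n) : ∀ w ∈ ω, ‖w‖ ≤ B := by
  have hω : ∃ (d : ℕ) (z : Fin d → ℂ), ω = Finset.univ.val.map z := by
    refine ⟨ω.toList.length, fun i => ω.toList.get i, ?_⟩
    conv_lhs => rw [← ω.coe_toList]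
    rw [Fin.univ_val_map, List.ofFn_get]
  obtain ⟨d, z, rfl⟩ := hω
  intro w hw
  obtain ⟨i, -, rfl⟩ := Multiset.mem_map.1 hw
  by_contra! hlt
  set u : Fin d → ℂ := fun j => if z j = 0 then 1 else z j / ‖z j‖ with hu
  have hu1 : ∀ j, ‖u j‖ = 1 := by
    intro j
    simp only [hu]
    split_ifs with hj
    · simp
    · rw [norm_div, Complex.norm_real, norm_norm, div_self (norm_ne_zero_iff.2 hj)]
  have hzu : ∀ j, z j = (‖z j‖ : ℂ) * u j := by
    intro j
    simp only [hu]
    split_ifs with hj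
    · simp [hj]
    · rw [mul_div_cancel₀]
      exact_mod_cast norm_ne_zero_iff.2 hj
  have hr : 1 < ‖z i‖ / B := (one_lt_div hB).2 hlt
  obtain ⟨n₁, hn₁⟩ := (tendsto_atTop.1 (tendsto_pow_atTop_atTop_of_one_lt hr) (2 * C + 1)).exists_forall_of_atTop
  obtain ⟨m, hm, hre⟩ := exists_ge_forall_half_le_re_pow u hu1 (max n₀ n₁)
  have h1 := hn₁ m ((le_max_right _ _).trans hm)
  have h2 := h m ((le_max_left _ _).trans hm)
  rw [Multiset.map_map] at h2
  change ‖∑ j, z j ^ m‖ ≤ _ at h2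
  have h3 : ∀ j, ‖z j‖ ^ m / 2 ≤ (z j ^ m).re := by
    intro j
    conv_rhs => rw [hzu j]
    rw [mul_pow, ← Complex.ofReal_pow, Complex.re_ofReal_mul]
    have := mul_le_mul_of_nonneg_left (hre j) (pow_nonneg (norm_nonneg (z j)) m)
    linarith
  have h4 : ‖z i‖ ^ m / 2 ≤ ‖∑ j, z j ^ m‖ := by
    refine le_trans ?_ (Complex.re_le_norm _)
    rw [Complex.re_sum]
    exact (h3 i).trans (Finset.single_le_sum (f := fun j => (z j ^ m).re)
      (fun j _ => le_trans (by positivity) (h3 j)) (Finset.mem_univ i))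
  rw [div_pow, le_div_iff₀ (by positivity)] at h1
  have : 0 < B ^ m := by positivity
  linarith

end PowerSumRadius

section MixedSums

variable {k : Type*} [Field k] [Fintype k] (L : ℕ → Type*) [∀ n, Field (L n)]
  [∀ n, Algebra k (L n)] [∀ n, FiniteDimensional k (L n)] [∀ n, Fintype (L n)]

theorem norm_sum_lam_minpolyPow_le {p : ℕ} (hp : p.Prime) (hp2 : Odd p) (hk : Fintype.card k = p)
    (hL : ∀ n, n ≠ 0 → Module.finrank k (L n) = n) {ψ : AddChar k ℂ} (hψ : ψ.IsPrimitive)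
    {A : Finset k} (hA : A.Nonempty) (hA2 : Even A.card) (h0 : (0 : k) ∉ A) (b : k) :
    ‖∑ x : L 1, lam (ψ.mulShift b) A (minpolyPow k x)‖ ≤ A.card * √p := by
  have : CharP k p := by
    have : Fact p.Prime := ⟨hp⟩
    exact charP_of_card_eq_prime hk
  have hchar : ringChar k ≠ 2 := by
    rw [ringChar.eq k p]
    rintro rfl
    exact absurd hp2 (by decide)
  choose ω hω hsum using fun b => exists_multiset_sum_lam_eq L hchar hL (ψ.mulShift b) hA
  have hbound : ∀ b, ∀ w ∈ ω b, ‖w‖ ≤ √p := by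
    intro b w hw
    obtain ⟨κ₀, hκ₀⟩ := (Filter.tendsto_atTop.1 (tendsto_pow_atTop_atTop_of_one_lt hp.one_lt)
      (2 * (p * A.card + 1) + 1)).exists_forall_of_atTop
    have key : ∀ n ≥ max κ₀ 1, ‖((∑ b, (ω b).map fun w => w ^ 2).map fun w => w ^ n).sum‖ ≤
        (1 + 5 * (p * A.card : ℕ) : ℝ) * (p : ℝ) ^ n := by
      intro n hn
      have hn0 : 2 * n ≠ 0 := by have := (le_max_right _ _).trans hn; omega
      have hcard : Fintype.card (L (2 * n)) = p ^ (2 * n) := by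
        rw [Module.card_eq_pow_finrank (K := k), hL _ hn0, hk]
      have h1 := abs_sum_quadraticChar_artinSchreier_le hp hp2 hk hcard hA h0
        (hκ₀ n ((le_max_left _ _).trans hn))
      have h2 : ((∑ b, (ω b).map fun w => w ^ 2).map fun w => w ^ n).sum =
          -((∑ z : L (2 * n), quadraticChar (L (2 * n))
            (∏ a ∈ A, (z ^ p - z - algebraMap k (L (2 * n)) a)) : ℤ) : ℂ) := by
        have h3 := sum_comp_frobeniusSub (L := L (2 * n))
          (fun x => (quadraticChar (L (2 * n)) (∏ a ∈ A, (x - algebraMap k _ a)) : ℂ)) hψ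
        rw [hk] at h3
        rw [Int.cast_sum, ← h3, ← Multiset.coe_mapAddMonoidHom, map_sum, ← Multiset.coe_sumAddMonoidHom,
          map_sum, ← Finset.sum_neg_distrib]
        refine Finset.sum_congr rfl fun b _ => ?_
        have h4 := hsum b (2 * n) hn0
        simp only [lam_minpolyPow hchar _ hA2, AddChar.mulShift_apply] at h4
        rw [h4, neg_neg, Multiset.coe_sumAddMonoidHom, Multiset.coe_mapAddMonoidHom,
          Multiset.map_map]
        simp only [Function.comp_def, ← pow_mul]
      rw [h2, norm_neg, Complex.norm_intCast]
      exact_mod_cast h1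
    have := norm_le_of_norm_sum_pow_le (Nat.cast_pos.2 hp.pos) key (w ^ 2)
      (Multiset.mem_sum.2 ⟨b, Finset.mem_univ b, Multiset.mem_map_of_mem _ hw⟩)
    rw [norm_pow] at this
    exact Real.le_sqrt_of_sq_le this
  rw [hsum b 1 one_ne_zero, norm_neg]
  simp only [pow_one, Multiset.map_id']
  calc ‖(ω b).sum‖ ≤ ((ω b).map fun w => ‖w‖).sum := norm_multiset_sum_le _
    _ ≤ (((ω b).map fun w => ‖w‖).card : ℕ) • √(p : ℝ) := by
      refine Multiset.sum_le_card_nsmul _ _ fun x hx => ?_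
      obtain ⟨w, hw, rfl⟩ := Multiset.mem_map.1 hx
      exact hbound b w hw
    _ ≤ A.card * √p := by
      rw [Multiset.card_map, nsmul_eq_mul]
      gcongr
      exact hω b

end MixedSums

section PrimeField

theorem norm_sum_quadraticChar_mul_addChar_le {p : ℕ} [Fact p.Prime] (hp2 : Odd p)
    {ψ : AddChar (ZMod p) ℂ} (hψ : ψ.IsPrimitive) {A : Finset (ZMod p)} (hA : A.Nonempty)
    (hA2 : Even A.card) (h0 : (0 : ZMod p) ∉ A) (b : ZMod p) :
    ‖∑ x : ZMod p, (quadraticChar (ZMod p) (∏ a ∈ A, (x - a)) : ℂ) * ψ (b * x)‖ ≤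
      A.card * √p := by
  have hp : p.Prime := Fact.out
  let L : ℕ → Type := fun n => GaloisField p n
  let _ : ∀ n, Fintype (L n) := fun n => Fintype.ofFinite (GaloisField p n)
  have hchar : ringChar (ZMod p) ≠ 2 := by
    rw [ZMod.ringChar_zmod_n]
    rintro rfl
    exact absurd hp2 (by decide)
  have hL : ∀ n, n ≠ 0 → Module.finrank (ZMod p) (L n) = n := fun n hn => GaloisField.finrank p hn
  have h := norm_sum_lam_minpolyPow_le L hp hp2 (ZMod.card p) hL hψ hA hA2 h0 b
  convert h using 2
  have hbij : Function.Bijective (algebraMap (ZMod p) (L 1)) := by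
    refine (Fintype.bijective_iff_injective_and_card _).2 ⟨(algebraMap (ZMod p) (L 1)).injective, ?_⟩
    rw [Module.card_eq_pow_finrank (K := ZMod p) (V := L 1), hL 1 one_ne_zero, pow_one]
  refine Fintype.sum_bijective _ hbij _ _ fun x => ?_
  rw [lam_minpolyPow hchar _ hA2]
  simp only [← map_sub, ← map_prod]
  rw [← quadraticChar_norm hchar, Algebra.norm_algebraMap, Algebra.trace_algebraMap, hL 1 one_ne_zero,
    pow_one, one_smul, AddChar.mulShift_apply]
  congr!

end PrimeField

section Completion

theorem inv_sin_pi_mul_le {x : ℝ} (h0 : 0 < x) (h1 : x < 1) :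
    (Real.sin (Real.pi * x))⁻¹ ≤ 2⁻¹ * (x⁻¹ + (1 - x)⁻¹) := by
  have key : ∀ y : ℝ, 0 < y → y ≤ 1 / 2 → 2 * y ≤ Real.sin (Real.pi * y) := by
    intro y hy hy2
    have := Real.mul_le_sin (x := Real.pi * y) (by positivity) (by nlinarith [Real.pi_pos])
    rwa [← mul_assoc, div_mul_cancel₀ _ Real.pi_ne_zero] at this
  have h2 : 0 < 1 - x := by linarith
  rcases le_total x (1 / 2) with h | h
  · calc (Real.sin (Real.pi * x))⁻¹ ≤ (2 * x)⁻¹ := by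
          gcongr
          exact key x h0 h
      _ = 2⁻¹ * x⁻¹ := by rw [mul_inv]
      _ ≤ _ := by
        gcongr
        have := inv_pos.2 h2
        linarith
  · have h3 : Real.sin (Real.pi * x) = Real.sin (Real.pi * (1 - x)) := by
      rw [← Real.sin_pi_sub]
      ring_nf
    rw [h3]
    calc (Real.sin (Real.pi * (1 - x)))⁻¹ ≤ (2 * (1 - x))⁻¹ := by
          gcongr
          exact key _ h2 (by linarith)
      _ = 2⁻¹ * (1 - x)⁻¹ := by rw [mul_inv]
      _ ≤ _ := by
        gcongr
        have := inv_pos.2 h0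
        linarith

variable {p : ℕ} [Fact p.Prime]

theorem norm_sum_range_stdAddChar_le {b : ZMod p} (hb : b ≠ 0) (N : ℕ) :
    ‖∑ m ∈ Finset.range N, ZMod.stdAddChar (-b * ((m + 1 : ℕ) : ZMod p))‖ ≤
      p / 2 * ((b.val : ℝ)⁻¹ + ((p : ℝ) - b.val)⁻¹) := by
  have hp : (0 : ℝ) < p := by exact_mod_cast (Fact.out : p.Prime).pos
  set z : ℂ := ZMod.stdAddChar (-b) with hz
  have hj0 : (0 : ℝ) < b.val := by exact_mod_cast (ZMod.val_pos.2 hb)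
  have hjp : (b.val : ℝ) < p := by exact_mod_cast ZMod.val_lt b
  have hterm : ∀ m : ℕ, ZMod.stdAddChar (-b * ((m + 1 : ℕ) : ZMod p)) = z * z ^ m := by
    intro m
    rw [mul_comm, ← nsmul_eq_mul, AddChar.map_nsmul_eq_pow, pow_succ']
  have hz1 : ‖z‖ = 1 := AddChar.norm_apply _ _
  have hsub : ‖z - 1‖ = 2 * Real.sin (Real.pi * (b.val / p)) := by
    have h1 : z = Complex.exp (Complex.I * ((-(2 * (Real.pi * (b.val / p))) : ℝ) : ℂ)) := by
      have h2 : -b = ((-(b.val : ℤ) : ℤ) : ZMod p) := by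
        push_cast
        rw [ZMod.natCast_zmod_val]
      rw [hz, h2, ZMod.stdAddChar_coe]
      congr 1
      push_cast
      ring
    rw [h1, Complex.norm_exp_I_mul_ofReal_sub_one, neg_div, Real.sin_neg, mul_neg, norm_neg,
      mul_div_cancel_left₀ _ two_ne_zero, Real.norm_of_nonneg]
    refine mul_nonneg zero_le_two (Real.sin_nonneg_of_nonneg_of_le_pi (by positivity) ?_)
    have : (b.val : ℝ) / p ≤ 1 := (div_le_one hp).2 hjp.le
    nlinarith [Real.pi_pos]
  have hx0 : (0 : ℝ) < b.val / p := by positivity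
  have hx1 : (b.val : ℝ) / p < 1 := (div_lt_one hp).2 hjp
  have hsin : 0 < Real.sin (Real.pi * (b.val / p)) :=
    Real.sin_pos_of_pos_of_lt_pi (by positivity) (by nlinarith [Real.pi_pos])
  rw [Finset.sum_congr rfl fun m _ => hterm m, ← Finset.mul_sum, norm_mul, hz1, one_mul]
  have hgeom := congrArg norm (mul_geom_sum z N)
  rw [norm_mul, hsub] at hgeom
  have hle : ‖z ^ N - 1‖ ≤ 2 := by
    refine (norm_sub_le _ _).trans ?_
    rw [norm_pow, hz1, one_pow, norm_one]
    norm_num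
  calc ‖∑ i ∈ Finset.range N, z ^ i‖ ≤ (Real.sin (Real.pi * (b.val / p)))⁻¹ := by
        rw [← one_div, le_div_iff₀ hsin]
        linarith
    _ ≤ _ := inv_sin_pi_mul_le hx0 hx1
    _ = p / 2 * ((b.val : ℝ)⁻¹ + ((p : ℝ) - b.val)⁻¹) := by
      have : (p : ℝ) - b.val ≠ 0 := by linarith
      field_simp

theorem sum_norm_sum_range_stdAddChar_le {N : ℕ} (hN : N ≤ p) :
    ∑ b : ZMod p, ‖∑ m ∈ Finset.range N, ZMod.stdAddChar (-b * ((m + 1 : ℕ) : ZMod p))‖ ≤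
      p * (2 + Real.log p) := by
  have hp : (0 : ℝ) < p := by exact_mod_cast (Fact.out : p.Prime).pos
  have h1 : ∀ b : ZMod p,
      ‖∑ m ∈ Finset.range N, ZMod.stdAddChar (-b * ((m + 1 : ℕ) : ZMod p))‖ ≤
        p / 2 * ((b.val : ℝ)⁻¹ + ((p : ℝ) - b.val)⁻¹) + if b = 0 then (p : ℝ) else 0 := by
    intro b
    split_ifs with hb
    · subst hb
      simp only [neg_zero, zero_mul, AddChar.map_zero_eq_one, Finset.sum_const, Finset.card_range,
        nsmul_eq_mul, mul_one, Complex.norm_natCast, ZMod.val_zero, Nat.cast_zero, inv_zero,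
        sub_zero, zero_add]
      have : (N : ℝ) ≤ p := by exact_mod_cast hN
      have : (0 : ℝ) ≤ p / 2 * (p : ℝ)⁻¹ := by positivity
      linarith
    · rw [add_zero]
      exact norm_sum_range_stdAddChar_le hb N
  have h2 : ∑ b : ZMod p, ((b.val : ℝ)⁻¹ + ((p : ℝ) - b.val)⁻¹) =
      ∑ j ∈ Finset.range p, ((j : ℝ)⁻¹ + ((p : ℝ) - j)⁻¹) := by
    refine Finset.sum_nbij' (fun b => b.val) (fun j => (j : ZMod p)) ?_ ?_ ?_ ?_ ?_
    · exact fun b _ => Finset.mem_range.2 (ZMod.val_lt b)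
    · simp
    · exact fun b _ => ZMod.natCast_zmod_val b
    · exact fun j hj => ZMod.val_natCast_of_lt (Finset.mem_range.1 hj)
    · simp
  set H : ℝ := ∑ j ∈ Finset.range p, ((j : ℝ) + 1)⁻¹ with hH
  have hHlog : H ≤ 1 + Real.log p := by
    have := harmonic_le_one_add_log p
    simpa [harmonic, hH] using this
  have h3 : ∑ j ∈ Finset.range p, (j : ℝ)⁻¹ ≤ H := by
    obtain ⟨n, hn⟩ := Nat.exists_eq_succ_of_ne_zero (Fact.out : p.Prime).ne_zero
    rw [hH, hn, Finset.sum_range_succ', Finset.sum_range_succ]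
    push_cast
    rw [inv_zero]
    gcongr
    positivity
  have h4 : ∑ j ∈ Finset.range p, ((p : ℝ) - j)⁻¹ = H := by
    rw [hH, ← Finset.sum_range_reflect]
    refine Finset.sum_congr rfl fun j hj => ?_
    have := Finset.mem_range.1 hj
    rw [Nat.sub_sub, Nat.cast_sub (by omega)]
    push_cast
    congr 1
    ring
  refine (Finset.sum_le_sum fun b _ => h1 b).trans ?_
  rw [Finset.sum_add_distrib, ← Finset.mul_sum, h2, Finset.sum_add_distrib, h4,
    Finset.sum_ite_eq' Finset.univ (0 : ZMod p), if_pos (Finset.mem_univ _)]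
  nlinarith

theorem norm_sum_range_le_of_norm_sum_mul_stdAddChar_le {f : ZMod p → ℂ} {W : ℝ}
    (hf : ∀ b, ‖∑ x, f x * ZMod.stdAddChar (b * x)‖ ≤ W) {N : ℕ} (hN : N ≤ p) :
    ‖∑ m ∈ Finset.range N, f ((m + 1 : ℕ) : ZMod p)‖ ≤ W * (2 + Real.log p) := by
  have hp : (0 : ℝ) < p := by exact_mod_cast (Fact.out : p.Prime).pos
  have hW : 0 ≤ W := (norm_nonneg _).trans (hf 0)
  have h1 : ∀ y : ZMod p, (p : ℂ) * f y =
      ∑ b, ZMod.stdAddChar (-b * y) * ∑ x, f x * ZMod.stdAddChar (b * x) := by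
    intro y
    have h2 : ∀ b x : ZMod p, ZMod.stdAddChar (-b * y) * (f x * ZMod.stdAddChar (b * x)) =
        f x * ZMod.stdAddChar (b * (x - y)) := by
      intro b x
      rw [mul_left_comm, ← AddChar.map_add_eq_mul]
      ring_nf
    simp only [Finset.mul_sum, h2]
    rw [Finset.sum_comm]
    simp only [← Finset.mul_sum, AddChar.sum_mulShift _ (ZMod.isPrimitive_stdAddChar p), sub_eq_zero,
      ZMod.card]
    simp [mul_comm]
  have h3 : (p : ℂ) * ∑ m ∈ Finset.range N, f ((m + 1 : ℕ) : ZMod p) =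
      ∑ b : ZMod p, (∑ m ∈ Finset.range N, ZMod.stdAddChar (-b * ((m + 1 : ℕ) : ZMod p))) *
        ∑ x, f x * ZMod.stdAddChar (b * x) := by
    rw [Finset.mul_sum, Finset.sum_congr rfl fun m _ => h1 _, Finset.sum_comm]
    simp only [Finset.sum_mul]
  have h4 : (p : ℝ) * ‖∑ m ∈ Finset.range N, f ((m + 1 : ℕ) : ZMod p)‖ ≤
      p * (2 + Real.log p) * W := by
    rw [← Complex.norm_natCast, ← norm_mul, h3]
    refine (norm_sum_le _ _).trans ?_
    rw [Complex.norm_natCast]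
    refine le_trans ?_ (mul_le_mul_of_nonneg_right (sum_norm_sum_range_stdAddChar_le hN) hW)
    rw [Finset.sum_mul]
    refine Finset.sum_le_sum fun b _ => ?_
    rw [norm_mul]
    exact mul_le_mul_of_nonneg_left (hf b) (norm_nonneg _)
  rw [mul_assoc] at h4
  linarith [le_of_mul_le_mul_left h4 hp]

theorem abs_sum_range_quadraticChar_le (hp2 : Odd p) {A : Finset (ZMod p)} (hA : A.Nonempty)
    (hA2 : Even A.card) (h0 : (0 : ZMod p) ∉ A) {N : ℕ} (hN : N ≤ p) :
    |((∑ m ∈ Finset.range N, quadraticChar (ZMod p) (∏ a ∈ A, (((m + 1 : ℕ) : ZMod p) - a)) : ℤ)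
      : ℝ)| ≤ A.card * √p * (2 + Real.log p) := by
  have := norm_sum_range_le_of_norm_sum_mul_stdAddChar_le
    (norm_sum_quadraticChar_mul_addChar_le hp2 (ZMod.isPrimitive_stdAddChar p) hA hA2 h0) hN
  rwa [← Int.cast_sum, Complex.norm_intCast] at this

end Completion

section Moments

theorem abs_prod_sub_prod_odd_le {ι κ : Type*} [Fintype ι] [Fintype κ] [DecidableEq κ]
    (α : ι → κ) {f : κ → ℤ}
    (hf : ∀ v, f v ∈ ({0, 1, -1} : Set ℤ)) :
    |∏ i, f (α i) - ∏ v ∈ Finset.univ.filter (fun v => Odd (Finset.univ.filter fun i => α i = v).card),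
      f v| ≤ ∑ i, if f (α i) = 0 then 1 else 0 := by
  have habs : ∀ v, |f v| ≤ 1 := by
    intro v
    rcases hf v with h | h | h <;> rw [h] <;> norm_num
  by_cases h0 : ∃ i, f (α i) = 0
  · obtain ⟨i, hi⟩ := h0
    rw [Finset.prod_eq_zero (Finset.mem_univ i) hi, zero_sub, abs_neg, Finset.abs_prod]
    calc _ ≤ (1 : ℤ) := Finset.prod_le_one (fun _ _ => abs_nonneg _) fun v _ => habs v
      _ = if f (α i) = 0 then 1 else 0 := (if_pos hi).symm
      _ ≤ _ := Finset.single_le_sum (f := fun i => if f (α i) = 0 then (1 : ℤ) else 0)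
        (fun j _ => by positivity) (Finset.mem_univ i)
  · push Not at h0
    have h1 : ∏ i, f (α i) = ∏ v, f v ^ (Finset.univ.filter fun i => α i = v).card := by
      rw [← Finset.prod_fiberwise Finset.univ α]
      refine Finset.prod_congr rfl fun v _ => ?_
      rw [← Finset.prod_const]
      exact Finset.prod_congr rfl fun i hi => by rw [(Finset.mem_filter.1 hi).2]
    have h2 : ∏ i, f (α i) = ∏ v ∈ Finset.univ.filter
        (fun v => Odd (Finset.univ.filter fun i => α i = v).card), f v := by
      rw [h1, Finset.prod_filter]
      refine Finset.prod_congr rfl fun v _ => ?_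
      split_ifs with hv
      · rcases hf v with h | h | h <;> rw [h]
        · exact zero_pow hv.pos.ne'
        · exact one_pow _
        · exact hv.neg_one_pow
      · rw [Nat.not_odd_iff_even] at hv
        rcases hf v with h | h | h
        · rw [Finset.filter_eq_empty_iff.2, Finset.card_empty, pow_zero]
          rintro i - rfl
          exact h0 i h
        · rw [h, one_pow]
        · rw [Set.mem_singleton_iff.1 h, hv.neg_one_pow]
    rw [h2, sub_self, abs_zero]
    exact Finset.sum_nonneg fun i _ => by positivity

variable {p : ℕ} [Fact p.Prime]

theorem sum_range_natCast_add_eq_zero_le {N : ℕ} (hN : N ≤ p) (c : ZMod p) :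
    ∑ m ∈ Finset.range N, (if ((m + 1 : ℕ) : ZMod p) + c = 0 then (1 : ℤ) else 0) ≤ 1 := by
  rw [Finset.sum_boole]
  norm_cast
  refine Finset.card_le_one.2 fun a ha b hb => ?_
  simp only [Finset.mem_filter, Finset.mem_range] at ha hb
  have h := add_right_cancel (ha.2.trans hb.2.symm)
  push_cast at h
  have h' := add_right_cancel h
  rw [ZMod.natCast_eq_natCast_iff'] at h'
  rwa [Nat.mod_eq_of_lt (by omega), Nat.mod_eq_of_lt (by omega)] at h'

theorem abs_sum_prod_quadraticChar_sub_le (hp2 : Odd p) {h N r : ℕ} (hh : h < p) (hN : N ≤ p)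
    (α : Fin (2 * r) → Fin h) :
    |((∑ m ∈ Finset.range N,
        ∏ i, quadraticChar (ZMod p) (((m + 1 : ℕ) : ZMod p) + ((α i : ℕ) + 1 : ℕ)) : ℤ) : ℝ) -
      if ∀ v : Fin h, Even (Finset.univ.filter fun i => α i = v).card then (N : ℝ) else 0| ≤
      2 * r + 2 * r * √p * (2 + Real.log p) := by
  set V : Finset (Fin h) :=
    Finset.univ.filter fun v => Odd (Finset.univ.filter fun i => α i = v).card with hV
  set f : ℕ → Fin h → ℤ := fun m v =>
    quadraticChar (ZMod p) (((m + 1 : ℕ) : ZMod p) + ((v : ℕ) + 1 : ℕ)) with hf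
  have hmain : ∀ m, |∏ i, f m (α i) - ∏ v ∈ V, f m v| ≤ ∑ i, if f m (α i) = 0 then 1 else 0 :=
    fun m => abs_prod_sub_prod_odd_le (f := f m) α fun v => quadraticChar_isQuadratic (ZMod p) _
  have hzero : |∑ m ∈ Finset.range N, ∏ i, f m (α i) - ∑ m ∈ Finset.range N, ∏ v ∈ V, f m v| ≤
      2 * r := by
    rw [← Finset.sum_sub_distrib]
    refine (Finset.abs_sum_le_sum_abs _ _).trans ((Finset.sum_le_sum fun m _ => hmain m).trans ?_)
    rw [Finset.sum_comm]
    simp only [hf, quadraticChar_eq_zero_iff]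
    refine (Finset.sum_le_sum fun i _ => sum_range_natCast_add_eq_zero_le hN _).trans ?_
    simp
  have hzero' : |((∑ m ∈ Finset.range N, ∏ i, f m (α i) : ℤ) : ℝ) -
      ((∑ m ∈ Finset.range N, ∏ v ∈ V, f m v : ℤ) : ℝ)| ≤ 2 * r := by
    exact_mod_cast hzero
  have hlog : 0 ≤ Real.log p := Real.log_natCast_nonneg p
  have hiff : (∀ v : Fin h, Even (Finset.univ.filter fun i => α i = v).card) ↔ V = ∅ := by
    rw [hV, Finset.filter_eq_empty_iff]
    simp
  change |((∑ m ∈ Finset.range N, ∏ i, f m (α i) : ℤ) : ℝ) - _| ≤ _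
  split_ifs with hVe <;> rw [hiff] at hVe
  · rw [hVe] at hzero'
    simp only [Finset.prod_empty, Finset.sum_const, Finset.card_range, nsmul_eq_mul, mul_one,
      Int.cast_natCast] at hzero'
    have : 0 ≤ 2 * r * √p * (2 + Real.log p) := by positivity
    linarith
  · rw [sub_zero]
    have hsum : ∑ v, (Finset.univ.filter fun i => α i = v).card = 2 * r := by
      rw [← Finset.card_eq_sum_card_fiberwise fun _ _ => Finset.mem_coe.2 (Finset.mem_univ _)]
      simp
    have hVeven : Even V.card := by
      rw [hV, ← Finset.even_sum_iff_even_card_odd, hsum]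
      exact even_two_mul r
    have hVcard : V.card ≤ 2 * r := by
      rw [← hsum, Finset.card_eq_sum_ones]
      refine (Finset.sum_le_sum fun v hv => ?_).trans
        (Finset.sum_le_univ_sum_of_nonneg fun v => Nat.zero_le _)
      exact (Finset.mem_filter.1 hv).2.pos
    set φ : Fin h → ZMod p := fun v => -(((v : ℕ) + 1 : ℕ) : ZMod p) with hφ
    have hφinj : Function.Injective φ := by
      intro v w hvw
      have h1 := neg_injective hvw
      rw [ZMod.natCast_eq_natCast_iff', Nat.mod_eq_of_lt (by omega), Nat.mod_eq_of_lt (by omega)] at h1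
      exact Fin.ext (by omega)
    have hcard : (V.image φ).card = V.card := Finset.card_image_of_injective _ hφinj
    have h0 : (0 : ZMod p) ∉ V.image φ := by
      intro h0
      obtain ⟨v, -, hv⟩ := Finset.mem_image.1 h0
      rw [hφ, neg_eq_zero, ZMod.natCast_eq_zero_iff] at hv
      have := Nat.le_of_dvd (by omega) hv
      omega
    have hbound := abs_sum_range_quadraticChar_le hp2
      ((Finset.nonempty_iff_ne_empty.2 hVe).image φ) (by rwa [hcard]) h0 hN
    have hprod : ∀ m : ℕ, quadraticChar (ZMod p)
        (∏ a ∈ V.image φ, (((m + 1 : ℕ) : ZMod p) - a)) = ∏ v ∈ V, f m v := by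
      intro m
      rw [Finset.prod_image fun _ _ _ _ h => hφinj h, map_prod]
      simp only [hφ, sub_neg_eq_add, hf]
    rw [Finset.sum_congr rfl fun m _ => hprod m, hcard] at hbound
    have hle : (V.card : ℝ) * √p * (2 + Real.log p) ≤ 2 * r * √p * (2 + Real.log p) := by
      gcongr
      exact_mod_cast hVcard
    have h2 := abs_sub_abs_le_abs_sub ((∑ m ∈ Finset.range N, ∏ i, f m (α i) : ℤ) : ℝ)
      ((∑ m ∈ Finset.range N, ∏ v ∈ V, f m v : ℤ) : ℝ)
    linarith

theorem S_natCast_eq_sum_quadraticChar (h m : ℕ) :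
    S h (m : ℝ) p = ∑ v : Fin h, quadraticChar (ZMod p) ((m : ZMod p) + ((v : ℕ) + 1 : ℕ)) := by
  rw [S, Fin.sum_univ_eq_sum_range
    (fun v => quadraticChar (ZMod p) ((m : ZMod p) + (v + 1 : ℕ))), Finset.range_eq_Ico,
    Finset.sum_Ico_add' (fun v => quadraticChar (ZMod p) ((m : ZMod p) + (v : ℕ))) 0 h 1]
  refine Finset.sum_congr rfl fun j _ => ?_
  rw [Int.floor_natCast, ← jacobiSym.legendreSym.to_jacobiSym, legendreSym]
  push_cast
  rfl

theorem sum_S_pow_eq (h N n : ℕ) :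
    ∑ m ∈ Finset.Icc 1 N, S h (m : ℝ) p ^ n = ∑ α : Fin n → Fin h, ∑ m ∈ Finset.range N,
      ∏ i, quadraticChar (ZMod p) (((m + 1 : ℕ) : ZMod p) + ((α i : ℕ) + 1 : ℕ)) := by
  rw [Finset.sum_comm, Finset.range_eq_Ico,
    Finset.sum_Ico_add' (fun m : ℕ => ∑ α : Fin n → Fin h,
      ∏ i, quadraticChar (ZMod p) ((m : ZMod p) + ((α i : ℕ) + 1 : ℕ))) 0 N 1]
  refine Finset.sum_congr rfl fun m _ => ?_
  rw [S_natCast_eq_sum_quadraticChar, Fintype.sum_pow]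

end Moments

theorem stmt12 (r : ℕ) (hr : 0 < r) :
    ∃ C > (0 : ℝ), ∀ q : ℕ, q.Prime → Odd q →
      ∀ h : ℕ, r ≤ h → h < q → ∀ g : ℝ, 1 ≤ g → g ≤ q →
        |(∑ m ∈ Finset.Icc 1 ⌊g⌋₊, ((S h (m : ℝ) q : ℝ)) ^ (2 * r))
            - (K r h : ℝ) * (⌊g⌋₊ : ℝ)|
          ≤ C * ((h : ℝ) ^ (2 * r) * Real.sqrt q * Real.log q + (h : ℝ) ^ r) := by
  refine ⟨8 * r, by positivity, fun q hq hq2 h _ hh g _ hg => ?_⟩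
  have : Fact q.Prime := ⟨hq⟩
  set N := ⌊g⌋₊
  have hN : N ≤ q := Nat.floor_le_of_le hg
  have hq3 : 3 ≤ q := by
    have := hq.two_le
    obtain ⟨j, hj⟩ := hq2
    omega
  have hq3' : (3 : ℝ) ≤ q := by exact_mod_cast hq3
  have hlog : 1 ≤ Real.log q := by
    rw [Real.le_log_iff_exp_le (by positivity)]
    linarith [Real.exp_one_lt_three]
  have hsqrt : 1 ≤ √(q : ℝ) := Real.one_le_sqrt.2 (by linarith)
  have hsum : ∑ m ∈ Finset.Icc 1 N, ((S h (m : ℝ) q : ℝ)) ^ (2 * r) =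
      ∑ α : Fin (2 * r) → Fin h, ((∑ m ∈ Finset.range N, ∏ i, quadraticChar (ZMod q)
        (((m + 1 : ℕ) : ZMod q) + ((α i : ℕ) + 1 : ℕ)) : ℤ) : ℝ) := by
    rw [← Int.cast_sum, ← sum_S_pow_eq]
    push_cast
    rfl
  have hK : (K r h : ℝ) * N = ∑ α : Fin (2 * r) → Fin h,
      if ∀ v : Fin h, Even (Finset.univ.filter fun i => α i = v).card then (N : ℝ) else 0 := by
    rw [← Finset.sum_filter, Finset.sum_const, nsmul_eq_mul, K]
  rw [hsum, hK, ← Finset.sum_sub_distrib]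
  have hterm : (2 * r + 2 * r * √q * (2 + Real.log q) : ℝ) ≤ 8 * r * (√q * Real.log q) := by
    have h1 : 1 ≤ √(q : ℝ) * Real.log q := one_le_mul_of_one_le_of_one_le hsqrt hlog
    have h2 : √(q : ℝ) ≤ √q * Real.log q := le_mul_of_one_le_right (by positivity) hlog
    have hr0 : (0 : ℝ) ≤ r := by positivity
    nlinarith [mul_le_mul_of_nonneg_left h1 hr0, mul_le_mul_of_nonneg_left h2 hr0]
  calc _ ≤ ∑ _α : Fin (2 * r) → Fin h, (8 * r * (√q * Real.log q) : ℝ) :=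
        (Finset.abs_sum_le_sum_abs _ _).trans <| Finset.sum_le_sum fun α _ =>
          (abs_sum_prod_quadraticChar_sub_le hq2 hh hN α).trans hterm
    _ = 8 * r * ((h : ℝ) ^ (2 * r) * √q * Real.log q) := by
      simp only [Finset.sum_const, Finset.card_univ, Fintype.card_fun, Fintype.card_fin,
        nsmul_eq_mul, Nat.cast_pow]
      ring
    _ ≤ _ := by
      gcongr
      exact le_add_of_nonneg_right (by positivity)
end
end

section
/- Fix η ∈ [0.01, 1]. There exists a constant C > 0 such that for all sufficiently large real Q there exist real numbers (λ_e), indexed by positive integers e, with the following properties: (i) λ_e = 0 whenever e > Q^{η/2}; (ii) for every positive integer n, Σ_{e | n} λ_e ≥ 0, and Σ_{e | n} λ_e ≥ 1 whenever every prime factor of n is ≥ Q^{η/4}; (iii) Σ_{n integer, Q < n ≤ Q+Q^η} Σ_{e | n} λ_e ≤ C·Q^η/log Q; and (iv) Σ_e |λ_e| ≤ C·Q^{η/2}/(log Q)². -/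
open Filter

noncomputable section

open Finset in
theorem sum_moebius_div_of_dvd {N k m : ℕ} (hk : k ≠ 0) (hm : m ∈ Icc 1 N) :
    ∑ d ∈ Icc 1 N with k ∣ d ∧ d ∣ m, (ArithmeticFunction.moebius (m / d) : ℝ) =
      if m = k then 1 else 0 := by
  rw [mem_Icc] at hm
  by_cases hkm : k ∣ m
  · obtain ⟨t, rfl⟩ := hkm
    have ht : t ≠ 0 := by rintro rfl; simp at hm
    have h1 : ∑ d ∈ Icc 1 N with k ∣ d ∧ d ∣ k * t,
        (ArithmeticFunction.moebius (k * t / d) : ℝ) =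
        ∑ e ∈ t.divisors, (ArithmeticFunction.moebius (t / e) : ℝ) := by
      symm
      refine sum_bij (fun e _ => k * e) ?_ ?_ ?_ ?_
      · intro e he
        have hd := Nat.dvd_of_mem_divisors he
        have hle := Nat.mul_le_mul_left k (Nat.le_of_dvd (Nat.pos_of_ne_zero ht) hd)
        have hpos : 0 < k * e :=
          Nat.mul_pos (Nat.pos_of_ne_zero hk) (Nat.pos_of_mem_divisors he)
        simp only [mem_filter, mem_Icc]
        exact ⟨⟨hpos, hle.trans hm.2⟩, dvd_mul_right _ _, mul_dvd_mul_left k hd⟩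
      · intro a _ b _ h
        exact Nat.eq_of_mul_eq_mul_left (Nat.pos_of_ne_zero hk) h
      · intro d hd
        simp only [mem_filter, mem_Icc] at hd
        obtain ⟨-, ⟨e, rfl⟩, h⟩ := hd
        exact ⟨e, Nat.mem_divisors.2
          ⟨(Nat.mul_dvd_mul_iff_left (Nat.pos_of_ne_zero hk)).1 h, ht⟩, rfl⟩
      · intro e _
        rw [Nat.mul_div_mul_left _ _ (Nat.pos_of_ne_zero hk)]
    rw [h1, Nat.sum_div_divisors t (fun e => (ArithmeticFunction.moebius e : ℝ))]
    have h2 := congrArg (fun f : ArithmeticFunction ℤ => f t)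
      ArithmeticFunction.moebius_mul_coe_zeta
    simp only [ArithmeticFunction.coe_mul_zeta_apply, ArithmeticFunction.one_apply] at h2
    have h3 : (k * t = k) ↔ t = 1 := by
      constructor
      · intro h
        exact Nat.eq_of_mul_eq_mul_left (Nat.pos_of_ne_zero hk) (by simpa using h)
      · rintro rfl; simp
    simp only [h3]
    exact_mod_cast h2
  · rw [if_neg (by rintro rfl; exact hkm dvd_rfl), filter_false_of_mem, sum_empty]
    rintro d - ⟨h1, h2⟩
    exact hkm (h1.trans h2)

/-- The sum of `μ(m)² / m` over `1 ≤ m ≤ N`. -/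
def squarefreeHarmonic (N : ℕ) : ℝ :=
  ∑ m ∈ Finset.Icc 1 N, (ArithmeticFunction.moebius m : ℝ) ^ 2 / m

/-- The unnormalised sieve weights of level `N`: the solution `w` of
`∑_{k ∣ d ≤ N} w(d) / d = μ(k) / k` for `k ≤ N`. -/
def sieveWeight (N d : ℕ) : ℝ :=
  d * ∑ m ∈ Finset.Icc 1 N with d ∣ m,
    (ArithmeticFunction.moebius (m / d) : ℝ) * (ArithmeticFunction.moebius m / m)

theorem sieveWeight_one (N : ℕ) : sieveWeight N 1 = squarefreeHarmonic N := by
  simp only [sieveWeight, squarefreeHarmonic, one_dvd, Finset.filter_true, Nat.div_one,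
    Nat.cast_one, one_mul]
  exact Finset.sum_congr rfl fun m _ => by ring

theorem abs_moebius_cast_le_one (m : ℕ) : |(ArithmeticFunction.moebius m : ℝ)| ≤ 1 := by
  exact_mod_cast ArithmeticFunction.abs_moebius_le_one (n := m)

open Finset in
theorem sum_sieveWeight_div {N k : ℕ} (hk : k ∈ Icc 1 N) :
    ∑ d ∈ Icc 1 N with k ∣ d, sieveWeight N d / d = (ArithmeticFunction.moebius k : ℝ) / k := by
  have hk0 : k ≠ 0 := by rw [mem_Icc] at hk; omega
  calc ∑ d ∈ Icc 1 N with k ∣ d, sieveWeight N d / d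
      = ∑ d ∈ Icc 1 N with k ∣ d, ∑ m ∈ Icc 1 N with d ∣ m,
          (ArithmeticFunction.moebius (m / d) : ℝ) * (ArithmeticFunction.moebius m / m) := by
        refine sum_congr rfl fun d hd => ?_
        have : (d : ℝ) ≠ 0 := by
          simp only [mem_filter, mem_Icc] at hd
          exact_mod_cast (by omega : d ≠ 0)
        rw [sieveWeight, mul_div_cancel_left₀ _ this]
    _ = ∑ m ∈ Icc 1 N, ∑ d ∈ Icc 1 N with k ∣ d ∧ d ∣ m,
          (ArithmeticFunction.moebius (m / d) : ℝ) * (ArithmeticFunction.moebius m / m) := by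
        apply sum_comm'
        intro d m
        simp only [mem_filter]
        tauto
    _ = ∑ m ∈ Icc 1 N, (if m = k then 1 else 0) * ((ArithmeticFunction.moebius m : ℝ) / m) := by
        refine sum_congr rfl fun m hm => ?_
        rw [← sum_mul, sum_moebius_div_of_dvd hk0 hm]
    _ = _ := by
        simp [ite_mul, sum_ite_eq', mem_Icc.1 hk]

open Finset in
theorem sum_sieveWeight_mul_div_lcm_le (N : ℕ) :
    ∑ a ∈ Icc 1 N, ∑ b ∈ Icc 1 N, sieveWeight N a * sieveWeight N b / (a.lcm b : ℝ) ≤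
      squarefreeHarmonic N := by
  have hpair : ∀ a ∈ Icc 1 N, ∀ b ∈ Icc 1 N,
      sieveWeight N a * sieveWeight N b / (a.lcm b : ℝ) =
        ∑ k ∈ Icc 1 N, (k.totient : ℝ) * ((if k ∣ a then sieveWeight N a / a else 0) *
          (if k ∣ b then sieveWeight N b / b else 0)) := by
    intro a ha b hb
    rw [mem_Icc] at ha hb
    have ha0 : (a : ℝ) ≠ 0 := by exact_mod_cast (by omega : a ≠ 0)
    have hb0 : (b : ℝ) ≠ 0 := by exact_mod_cast (by omega : b ≠ 0)
    have hg : ((a.gcd b : ℕ) : ℝ) =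
        ∑ k ∈ Icc 1 N with k ∣ a ∧ k ∣ b, (k.totient : ℝ) := by
      have hset : (Icc 1 N).filter (fun k => k ∣ a ∧ k ∣ b) = (a.gcd b).divisors := by
        ext k
        simp only [mem_filter, mem_Icc, Nat.mem_divisors, Nat.dvd_gcd_iff]
        constructor
        · rintro ⟨-, h⟩
          exact ⟨h, Nat.gcd_ne_zero_left (by omega)⟩
        · rintro ⟨h, -⟩
          have := Nat.le_of_dvd (by omega) h.1
          have := Nat.pos_of_dvd_of_pos h.1 (by omega)
          exact ⟨by omega, h⟩
      rw [hset]
      exact_mod_cast (Nat.sum_totient (a.gcd b)).symm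
    have hl0 : ((a.lcm b : ℕ) : ℝ) ≠ 0 := by
      exact_mod_cast Nat.lcm_ne_zero (by omega) (by omega)
    have hgl : ((a.gcd b : ℕ) : ℝ) * (a.lcm b : ℕ) = a * b := by
      exact_mod_cast Nat.gcd_mul_lcm a b
    calc sieveWeight N a * sieveWeight N b / (a.lcm b : ℝ)
        = (a.gcd b : ℕ) * (sieveWeight N a / a * (sieveWeight N b / b)) := by
          field_simp
          linear_combination (-sieveWeight N a * sieveWeight N b) * hgl
      _ = _ := by
          rw [hg, sum_mul, sum_filter]
          refine sum_congr rfl fun k _ => ?_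
          by_cases h1 : k ∣ a <;> by_cases h2 : k ∣ b <;> simp [h1, h2]
  calc ∑ a ∈ Icc 1 N, ∑ b ∈ Icc 1 N, sieveWeight N a * sieveWeight N b / (a.lcm b : ℝ)
      = ∑ k ∈ Icc 1 N, (k.totient : ℝ) *
          (∑ d ∈ Icc 1 N with k ∣ d, sieveWeight N d / d) ^ 2 := by
        rw [sum_congr rfl fun a ha => sum_congr rfl fun b hb => hpair a ha b hb]
        rw [sum_congr rfl fun a _ => sum_comm, sum_comm]
        refine sum_congr rfl fun k _ => ?_
        rw [sum_filter, sq, sum_mul_sum, mul_sum]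
        exact sum_congr rfl fun a _ => by rw [mul_sum]
    _ ≤ squarefreeHarmonic N := by
        refine sum_le_sum fun k hk => ?_
        rw [sum_sieveWeight_div hk]
        have hk0 : (0 : ℝ) < k := by exact_mod_cast (mem_Icc.1 hk).1
        have hphi : (k.totient : ℝ) ≤ k := by exact_mod_cast Nat.totient_le k
        calc (k.totient : ℝ) * ((ArithmeticFunction.moebius k : ℝ) / k) ^ 2
            ≤ k * ((ArithmeticFunction.moebius k : ℝ) / k) ^ 2 := by gcongr
          _ = _ := by field_simp

open Finset in
theorem sum_Icc_inv_sq_le_two (N : ℕ) : ∑ d ∈ Icc 1 N, ((d : ℝ) ^ 2)⁻¹ ≤ 2 := by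
  have h := sum_Ioo_inv_sq_le (α := ℝ) 0 (N + 1)
  have hs : Ioo 0 (N + 1) = Icc 1 N := by ext; simp only [mem_Ioo, mem_Icc]; omega
  rw [hs] at h
  simpa using h

open Finset in
theorem sum_abs_sieveWeight_le (N : ℕ) : ∑ d ∈ Icc 1 N, |sieveWeight N d| ≤ 2 * N := by
  calc ∑ d ∈ Icc 1 N, |sieveWeight N d|
      ≤ ∑ d ∈ Icc 1 N, ∑ m ∈ Icc 1 N with d ∣ m, (d : ℝ) / m := by
        refine sum_le_sum fun d _ => ?_
        rw [sieveWeight, mul_sum]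
        refine (abs_sum_le_sum_abs _ _).trans (sum_le_sum fun m _ => ?_)
        rw [abs_mul, abs_mul, abs_div, Nat.abs_cast, Nat.abs_cast, div_eq_mul_inv (d : ℝ)]
        have h1 := abs_moebius_cast_le_one (m / d)
        have h2 := abs_moebius_cast_le_one m
        gcongr
        calc _ ≤ (1 : ℝ) * (1 / m) := by gcongr
          _ = _ := by ring
    _ = ∑ m ∈ Icc 1 N, ∑ d ∈ m.divisors, (d : ℝ) / m := by
        apply sum_comm'
        intro d m
        simp only [mem_filter, mem_Icc, Nat.mem_divisors]
        constructor
        · rintro ⟨h1, h2, h3⟩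
          exact ⟨⟨h3, by omega⟩, h2⟩
        · rintro ⟨⟨h1, h2⟩, h3⟩
          have := Nat.le_of_dvd (by omega) h1
          have := Nat.pos_of_dvd_of_pos h1 (by omega)
          exact ⟨by omega, h3, h1⟩
    _ = ∑ m ∈ Icc 1 N, ∑ d ∈ m.divisors, (1 : ℝ) / d := by
        refine sum_congr rfl fun m hm => ?_
        rw [← Nat.sum_div_divisors m (fun d => (d : ℝ) / m)]
        refine sum_congr rfl fun d hd => ?_
        have hm0 : (m : ℝ) ≠ 0 := by
          rw [mem_Icc] at hm; exact_mod_cast (by omega : m ≠ 0)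
        have hd0 : (d : ℝ) ≠ 0 := by exact_mod_cast (Nat.pos_of_mem_divisors hd).ne'
        rw [Nat.cast_div (Nat.dvd_of_mem_divisors hd) hd0]
        field_simp
    _ = ∑ d ∈ Icc 1 N, ∑ m ∈ Ioc 0 N with d ∣ m, (1 : ℝ) / d := by
        apply sum_comm'
        intro m d
        simp only [mem_filter, mem_Icc, mem_Ioc, Nat.mem_divisors]
        constructor
        · rintro ⟨h3, h1, h2⟩
          have := Nat.le_of_dvd (by omega) h1
          have := Nat.pos_of_dvd_of_pos h1 (by omega)
          exact ⟨⟨by omega, h1⟩, by omega⟩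
        · rintro ⟨⟨h1, h2⟩, h3⟩
          exact ⟨by omega, h2, by omega⟩
    _ ≤ ∑ d ∈ Icc 1 N, (N : ℝ) * ((d : ℝ) ^ 2)⁻¹ := by
        refine sum_le_sum fun d _ => ?_
        rw [sum_const, Nat.Ioc_filter_dvd_card_eq_div, nsmul_eq_mul]
        calc ((N / d : ℕ) : ℝ) * (1 / d) ≤ (N / d : ℝ) * (1 / d) := by
              gcongr; exact Nat.cast_div_le
          _ = _ := by ring
    _ ≤ 2 * N := by
        rw [← mul_sum, mul_comm]
        gcongr
        exact sum_Icc_inv_sq_le_two N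

open Finset in
theorem log_le_two_mul_squarefreeHarmonic (N : ℕ) :
    Real.log (N + 1 : ℝ) ≤ 2 * squarefreeHarmonic N := by
  choose a b hab ha using Nat.sq_mul_squarefree
  have hlog : Real.log (N + 1 : ℝ) ≤ ∑ n ∈ Icc 1 N, (n : ℝ)⁻¹ := by
    have h := log_add_one_le_harmonic N
    rw [harmonic_eq_sum_Icc] at h
    push_cast at h
    exact h
  have hinj : Set.InjOn (fun n => (a n, b n)) (Icc 1 N : Finset ℕ) := by
    intro m _ n _ h
    simp only [Prod.mk.injEq] at h
    rw [← hab m, ← hab n, h.1, h.2]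
  calc Real.log (N + 1 : ℝ) ≤ ∑ n ∈ Icc 1 N, (n : ℝ)⁻¹ := hlog
    _ = ∑ n ∈ Icc 1 N, (ArithmeticFunction.moebius (a n) : ℝ) ^ 2 / (a n) *
          ((b n : ℝ) ^ 2)⁻¹ := by
        refine sum_congr rfl fun n _ => ?_
        have h1 : (ArithmeticFunction.moebius (a n) : ℝ) ^ 2 = 1 := by
          exact_mod_cast ArithmeticFunction.moebius_sq_eq_one_of_squarefree (ha n)
        have h2 : (n : ℝ) = (b n : ℝ) ^ 2 * a n := by exact_mod_cast (hab n).symm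
        rw [h1, h2, mul_inv]
        ring
    _ = ∑ p ∈ (Icc 1 N).image (fun n => (a n, b n)),
          (ArithmeticFunction.moebius p.1 : ℝ) ^ 2 / p.1 * ((p.2 : ℝ) ^ 2)⁻¹ := by
        rw [sum_image hinj]
    _ ≤ ∑ p ∈ Icc 1 N ×ˢ Icc 1 N,
          (ArithmeticFunction.moebius p.1 : ℝ) ^ 2 / p.1 * ((p.2 : ℝ) ^ 2)⁻¹ := by
        refine sum_le_sum_of_subset_of_nonneg ?_ fun p _ _ => by positivity
        intro p hp
        obtain ⟨n, hn, rfl⟩ := mem_image.1 hp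
        rw [mem_Icc] at hn
        have h0 : b n ^ 2 * a n ≠ 0 := by rw [hab n]; omega
        have hb : b n ≠ 0 := by rintro h; simp [h] at h0
        have ha0 : a n ≠ 0 := by rintro h; simp [h] at h0
        have h1 : a n ≤ n := Nat.le_of_dvd (by omega) ⟨b n ^ 2, by rw [mul_comm, hab n]⟩
        have h2 : b n ≤ n := Nat.le_of_dvd (by omega) ⟨b n * a n, by rw [← mul_assoc, ← sq, hab n]⟩
        simp only [mem_product, mem_Icc]
        omega
    _ = squarefreeHarmonic N * ∑ d ∈ Icc 1 N, ((d : ℝ) ^ 2)⁻¹ := by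
        rw [sum_product, squarefreeHarmonic, sum_mul_sum]
    _ ≤ squarefreeHarmonic N * 2 := by
        have : 0 ≤ squarefreeHarmonic N := sum_nonneg fun _ _ => by positivity
        gcongr
        exact sum_Icc_inv_sq_le_two N
    _ = _ := mul_comm _ _

/-- The coefficients of the square of the divisor sum of `w` over `d ≤ N`. -/
def lambdaSq (N : ℕ) (w : ℕ → ℝ) (e : ℕ) : ℝ :=
  ∑ a ∈ Finset.Icc 1 N, ∑ b ∈ Finset.Icc 1 N, if a.lcm b = e then w a * w b else 0

theorem lambdaSq_eq_zero {N e : ℕ} (w : ℕ → ℝ) (he : N ^ 2 < e) : lambdaSq N w e = 0 := by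
  refine Finset.sum_eq_zero fun a ha => Finset.sum_eq_zero fun b hb => if_neg ?_
  rw [Finset.mem_Icc] at ha hb
  have h1 : a.lcm b ≤ a * b :=
    Nat.le_of_dvd (Nat.mul_pos (by omega) (by omega)) (Nat.lcm_dvd_mul a b)
  have h2 : a * b ≤ N * N := Nat.mul_le_mul ha.2 hb.2
  rintro rfl
  nlinarith

open Finset in
theorem sum_divisors_lambdaSq_eq_sum_sum {n : ℕ} (N : ℕ) (w : ℕ → ℝ) (hn : n ≠ 0) :
    ∑ e ∈ n.divisors, lambdaSq N w e =
      ∑ a ∈ Icc 1 N, ∑ b ∈ Icc 1 N, if a.lcm b ∣ n then w a * w b else 0 := by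
  unfold lambdaSq
  rw [sum_comm]
  refine sum_congr rfl fun a _ => ?_
  rw [sum_comm]
  refine sum_congr rfl fun b _ => ?_
  rw [sum_ite_eq]
  simp [hn]

open Finset in
theorem sum_divisors_lambdaSq {n : ℕ} (N : ℕ) (w : ℕ → ℝ) (hn : n ≠ 0) :
    ∑ e ∈ n.divisors, lambdaSq N w e = (∑ d ∈ Icc 1 N with d ∣ n, w d) ^ 2 := by
  rw [sum_divisors_lambdaSq_eq_sum_sum N w hn, sum_filter, sq, sum_mul_sum]
  refine sum_congr rfl fun a _ => sum_congr rfl fun b _ => ?_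
  by_cases h1 : a ∣ n <;> by_cases h2 : b ∣ n <;> simp [Nat.lcm_dvd_iff, h1, h2]

open Finset in
theorem tsum_abs_lambdaSq_le (N : ℕ) (w : ℕ → ℝ) :
    ∑' e, |lambdaSq N w e| ≤ (∑ d ∈ Icc 1 N, |w d|) ^ 2 := by
  have hsupp : ∀ e ∉ range (N ^ 2 + 1), |lambdaSq N w e| = 0 := by
    intro e he
    rw [mem_range] at he
    rw [lambdaSq_eq_zero w (by omega), abs_zero]
  rw [tsum_eq_sum hsupp]
  calc ∑ e ∈ range (N ^ 2 + 1), |lambdaSq N w e|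
      ≤ ∑ e ∈ range (N ^ 2 + 1), ∑ a ∈ Icc 1 N, ∑ b ∈ Icc 1 N,
          if a.lcm b = e then |w a| * |w b| else 0 := by
        refine sum_le_sum fun e _ => (abs_sum_le_sum_abs _ _).trans (sum_le_sum fun a _ =>
          (abs_sum_le_sum_abs _ _).trans (sum_le_sum fun b _ => ?_))
        split_ifs <;> simp [abs_mul]
    _ ≤ (∑ d ∈ Icc 1 N, |w d|) ^ 2 := by
        rw [sum_comm, sq (∑ d ∈ Icc 1 N, |w d|), sum_mul_sum]
        refine sum_le_sum fun a _ => ?_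
        rw [sum_comm]
        refine sum_le_sum fun b _ => ?_
        rw [sum_ite_eq]
        split_ifs
        · exact le_rfl
        · positivity

open Finset in
theorem abs_card_multiples_sub_le {Q X : ℝ} (hQ : 0 ≤ Q) (hX : 0 ≤ X) (r : ℕ) :
    |(#{n ∈ Ioc ⌊Q⌋₊ ⌊Q + X⌋₊ | r ∣ n} : ℝ) - X / r| ≤ 1 := by
  have hle : ⌊Q⌋₊ ≤ ⌊Q + X⌋₊ := Nat.floor_mono (by linarith)
  have hcard : (#{n ∈ Ioc ⌊Q⌋₊ ⌊Q + X⌋₊ | r ∣ n} : ℝ) =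
      (⌊(Q + X) / r⌋₊ : ℝ) - ⌊Q / r⌋₊ := by
    rw [Nat.floor_div_natCast, Nat.floor_div_natCast, ← Nat.Ioc_filter_dvd_card_eq_div,
      ← Nat.Ioc_filter_dvd_card_eq_div, ← Ioc_union_Ioc_eq_Ioc (Nat.zero_le _) hle, filter_union,
      card_union_of_disjoint]
    · push_cast; ring
    · exact disjoint_filter_filter (Ioc_disjoint_Ioc_of_le le_rfl)
  rw [hcard, abs_le]
  have h1 := Nat.floor_le (a := (Q + X) / r) (by positivity)
  have h2 := Nat.lt_floor_add_one ((Q + X) / r)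
  have h3 := Nat.floor_le (a := Q / r) (by positivity)
  have h4 := Nat.lt_floor_add_one (Q / r)
  rw [add_div] at *
  constructor <;> linarith

open Finset in
theorem sum_Ioc_sum_divisors_lambdaSq_le {Q X : ℝ} (hQ : 0 ≤ Q) (hX : 0 ≤ X) (N : ℕ)
    (w : ℕ → ℝ) :
    ∑ n ∈ Ioc ⌊Q⌋₊ ⌊Q + X⌋₊, ∑ e ∈ n.divisors, lambdaSq N w e ≤
      X * ∑ a ∈ Icc 1 N, ∑ b ∈ Icc 1 N, w a * w b / (a.lcm b : ℝ) +
        (∑ d ∈ Icc 1 N, |w d|) ^ 2 := by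
  calc ∑ n ∈ Ioc ⌊Q⌋₊ ⌊Q + X⌋₊, ∑ e ∈ n.divisors, lambdaSq N w e
      = ∑ n ∈ Ioc ⌊Q⌋₊ ⌊Q + X⌋₊, ∑ a ∈ Icc 1 N, ∑ b ∈ Icc 1 N,
          if a.lcm b ∣ n then w a * w b else 0 := by
        refine sum_congr rfl fun n hn => sum_divisors_lambdaSq_eq_sum_sum N w ?_
        rw [mem_Ioc] at hn
        omega
    _ = ∑ a ∈ Icc 1 N, ∑ b ∈ Icc 1 N,
          (#{n ∈ Ioc ⌊Q⌋₊ ⌊Q + X⌋₊ | a.lcm b ∣ n} : ℝ) * (w a * w b) := by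
        rw [sum_comm]
        refine sum_congr rfl fun a _ => ?_
        rw [sum_comm]
        refine sum_congr rfl fun b _ => ?_
        rw [← sum_filter, sum_const, nsmul_eq_mul]
    _ ≤ ∑ a ∈ Icc 1 N, ∑ b ∈ Icc 1 N,
          (X * (w a * w b / (a.lcm b : ℝ)) + |w a| * |w b|) := by
        refine sum_le_sum fun a _ => sum_le_sum fun b _ => ?_
        have h := mul_le_mul_of_nonneg_right (abs_card_multiples_sub_le hQ hX (a.lcm b))
          (abs_nonneg (w a * w b))
        rw [← abs_mul] at h
        have h' := (le_abs_self _).trans h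
        rw [one_mul, abs_mul] at h'
        have : X * (w a * w b / (a.lcm b : ℝ)) = X / (a.lcm b : ℝ) * (w a * w b) := by ring
        rw [this]
        linarith
    _ = _ := by
        rw [sq, sum_mul_sum]
        simp only [sum_add_distrib, mul_sum]

theorem stmt15 (η : ℝ) (hη : η ∈ Set.Icc (0.01 : ℝ) 1) :
    ∃ C > (0 : ℝ), ∀ᶠ Q : ℝ in atTop, ∃ lam : ℕ → ℝ,
      (∀ e : ℕ, Q ^ (η / 2) < (e : ℝ) → lam e = 0) ∧
      (∀ n : ℕ, 0 < n → 0 ≤ ∑ e ∈ n.divisors, lam e) ∧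
      (∀ n : ℕ, 0 < n → (∀ p : ℕ, p.Prime → p ∣ n → Q ^ (η / 4) ≤ (p : ℝ)) →
        1 ≤ ∑ e ∈ n.divisors, lam e) ∧
      (∑ n ∈ Finset.Ioc ⌊Q⌋₊ ⌊Q + Q ^ η⌋₊, ∑ e ∈ n.divisors, lam e
        ≤ C * Q ^ η / Real.log Q) ∧
      (∑' e : ℕ, |lam e| ≤ C * Q ^ (η / 2) / Real.log Q ^ 2) := by
  have hη0 : 0 < η := lt_of_lt_of_le (by norm_num) hη.1
  refine ⟨8 / η + 256 / η ^ 2, by positivity, ?_⟩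
  filter_upwards [eventually_ge_atTop (Real.exp 1)] with Q hQe
  have hQ0 : 0 < Q := (Real.exp_pos 1).trans_le hQe
  have hlog : 1 ≤ Real.log Q := (Real.le_log_iff_exp_le hQ0).2 hQe
  have hQ1 : 1 < Q := (Real.log_pos_iff hQ0.le).1 (by linarith)
  have hz1 : 1 < Q ^ (η / 4) := Real.one_lt_rpow hQ1 (by positivity)
  have hzsq : (Q ^ (η / 4)) ^ 2 = Q ^ (η / 2) := by
    rw [← Real.rpow_natCast, ← Real.rpow_mul hQ0.le]
    congr 1
    push_cast
    ring
  obtain ⟨N, hN⟩ : ∃ N, ⌈Q ^ (η / 4)⌉₊ = N + 1 :=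
    Nat.exists_eq_succ_of_ne_zero (Nat.ceil_pos.2 (by linarith)).ne'
  have hzN : Q ^ (η / 4) ≤ N + 1 := by
    have := Nat.le_ceil (Q ^ (η / 4))
    rw [hN] at this
    exact_mod_cast this
  have hNz : (N : ℝ) < Q ^ (η / 4) := Nat.lt_ceil.1 (by omega)
  have hN1 : 1 ≤ N := by
    have : (0 : ℝ) < N := by linarith
    exact_mod_cast this
  have hNsq : (N : ℝ) ^ 2 ≤ Q ^ (η / 2) := by
    rw [← hzsq]
    gcongr
  have hL : η / 8 * Real.log Q ≤ squarefreeHarmonic N := by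
    have h1 := Real.log_le_log (by linarith) hzN
    rw [Real.log_rpow hQ0] at h1
    have h2 := log_le_two_mul_squarefreeHarmonic N
    linarith
  have hL' : 0 < η / 8 * Real.log Q := by positivity
  have hL0 : 0 < squarefreeHarmonic N := hL'.trans_le hL
  have habs : (∑ d ∈ Finset.Icc 1 N, |sieveWeight N d|) ^ 2 / squarefreeHarmonic N ^ 2 ≤
      256 / η ^ 2 * Q ^ (η / 2) / Real.log Q ^ 2 := by
    calc _ ≤ (2 * N : ℝ) ^ 2 / (η / 8 * Real.log Q) ^ 2 := by
          gcongr
          exact sum_abs_sieveWeight_le N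
      _ = 256 / η ^ 2 * (N : ℝ) ^ 2 / Real.log Q ^ 2 := by
          field_simp
          ring
      _ ≤ _ := by gcongr
  refine ⟨fun e => lambdaSq N (sieveWeight N) e / squarefreeHarmonic N ^ 2, ?_, ?_, ?_, ?_, ?_⟩
  · intro e he
    have : N ^ 2 < e := by exact_mod_cast hNsq.trans_lt he
    simp only [lambdaSq_eq_zero _ this, zero_div]
  · intro n hn
    rw [← Finset.sum_div, sum_divisors_lambdaSq _ _ hn.ne']
    positivity
  · intro n hn hp
    rw [← Finset.sum_div, sum_divisors_lambdaSq _ _ hn.ne']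
    have hone : (Finset.Icc 1 N).filter (fun d => d ∣ n) = {1} := by
      ext d
      simp only [Finset.mem_filter, Finset.mem_Icc, Finset.mem_singleton]
      constructor
      · rintro ⟨⟨h1, h2⟩, h3⟩
        by_contra hd
        have h4 := hp d.minFac (Nat.minFac_prime hd) ((Nat.minFac_dvd d).trans h3)
        have h5 : (d.minFac : ℝ) ≤ N := by exact_mod_cast (Nat.minFac_le h1).trans h2
        linarith
      · rintro rfl
        exact ⟨⟨le_rfl, hN1⟩, one_dvd n⟩
    rw [hone, Finset.sum_singleton, sieveWeight_one, div_self (by positivity)]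
  · simp only [← Finset.sum_div]
    have hpow : Q ^ (η / 2) ≤ Q ^ η := Real.rpow_le_rpow_of_exponent_le hQ1.le (by linarith)
    have hX : 0 ≤ Q ^ η := by positivity
    calc _ ≤ (Q ^ η * squarefreeHarmonic N +
          (∑ d ∈ Finset.Icc 1 N, |sieveWeight N d|) ^ 2) / squarefreeHarmonic N ^ 2 := by
          gcongr
          refine (sum_Ioc_sum_divisors_lambdaSq_le hQ0.le hX N _).trans ?_
          gcongr
          exact sum_sieveWeight_mul_div_lcm_le N
      _ = Q ^ η / squarefreeHarmonic N +
          (∑ d ∈ Finset.Icc 1 N, |sieveWeight N d|) ^ 2 / squarefreeHarmonic N ^ 2 := by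
          field_simp
      _ ≤ Q ^ η / (η / 8 * Real.log Q) + 256 / η ^ 2 * Q ^ η / Real.log Q := by
          refine add_le_add (by gcongr) (habs.trans ?_)
          gcongr
          nlinarith
      _ = _ := by
          field_simp
  · simp only [abs_div, abs_of_pos (pow_pos hL0 2)]
    rw [tsum_div_const]
    calc _ ≤ (∑ d ∈ Finset.Icc 1 N, |sieveWeight N d|) ^ 2 / squarefreeHarmonic N ^ 2 := by
          gcongr
          exact tsum_abs_lambdaSq_le N _
      _ ≤ _ := habs
      _ ≤ _ := by
          gcongr
          have : 0 < 8 / η := by positivity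
          linarith
end
end
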